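/- arXiv:math/0107013 — 2 statements merged into one kernel-verified Lean document; each statement's English description precedes it below -/
import Mathlib

section
/- Let Q define the germ at 0 of a real-analytic hypersurface M ⊂ ℂ² in normal coordinates, not Levi-flat near 0 (Q(z,χ,τ) ≢ τ). Let H : (ℂ²,0) → (ℂ²,0) be a local biholomorphism satisfying the mapping identity with Q′ = Q (i.e., sending M into itself) and suppose H is tangent to the identity at 0, i.e., the Jacobian matrix H′(0) is the identity matrix. Then H(z,0) = (z,0) for all z ∈ ℂ near 0; in particular, H fixes pointwise the complex hypersurface {w = 0} through 0. -/
open Filter Topology Matrix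

noncomputable section

/-- Complex conjugation as a plain function. -/
def cj : ℂ → ℂ := (starRingEnd ℂ)

/-- Iterated partial derivative `∂_z^i ∂_w^j F (z, w)` of `F : ℂ → ℂ → ℂ`. -/
def pd (F : ℂ → ℂ → ℂ) (i j : ℕ) (z w : ℂ) : ℂ :=
  deriv^[i] (fun z' => deriv^[j] (F z') w) z

/-- `Q` is a normal-coordinates defining function (near `0`) of a germ of a
real-analytic hypersurface in `ℂ²`. -/
def IsNormalCoord (Q : ℂ → ℂ → ℂ → ℂ) : Prop :=
  AnalyticAt ℂ (fun p : ℂ × ℂ × ℂ => Q p.1 p.2.1 p.2.2) 0 ∧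
  (∀ᶠ p : ℂ × ℂ in 𝓝 0, Q p.1 0 p.2 = p.2) ∧
  (∀ᶠ p : ℂ × ℂ in 𝓝 0, Q 0 p.1 p.2 = p.2) ∧
  (∀ᶠ p : ℂ × ℂ × ℂ in 𝓝 0, Q p.1 p.2.1 (cj (Q (cj p.2.1) (cj p.1) (cj p.2.2))) = p.2.2)

/-- The mapping identity expressing that the germ at `0` of the holomorphic map
`H = (F, G)` (with `H(0) = 0`) sends the hypersurface defined by `Q` into the one
defined by `Q'`. -/
def SendsInto (Q Q' : ℂ → ℂ → ℂ → ℂ) (F G : ℂ → ℂ → ℂ) : Prop :=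
  AnalyticAt ℂ (fun p : ℂ × ℂ => F p.1 p.2) 0 ∧
  AnalyticAt ℂ (fun p : ℂ × ℂ => G p.1 p.2) 0 ∧
  F 0 0 = 0 ∧ G 0 0 = 0 ∧
  ∀ᶠ p : ℂ × ℂ × ℂ in 𝓝 0,
    G p.1 (Q p.1 p.2.1 p.2.2) =
      Q' (F p.1 (Q p.1 p.2.1 p.2.2)) (cj (F (cj p.2.1) (cj p.2.2))) (cj (G (cj p.2.1) (cj p.2.2)))

/-- Determinant of the Jacobian matrix of `H = (F, G)` at `0`. -/
def JacDet (F G : ℂ → ℂ → ℂ) : ℂ :=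
  pd F 1 0 0 0 * pd G 0 1 0 0 - pd F 0 1 0 0 * pd G 1 0 0 0

/-- The hypersurface defined by `Q` is not Levi-flat near `0`, i.e. `Q(z,χ,τ) ≢ τ`. -/
def NotLeviFlat (Q : ℂ → ℂ → ℂ → ℂ) : Prop :=
  ¬ ∀ᶠ p : ℂ × ℂ × ℂ in 𝓝 0, Q p.1 p.2.1 p.2.2 = p.2.2

/-- The hypersurface defined by `Q` is of finite type at `0`, i.e. `Q(z,χ,0) ≢ 0`. -/
def FiniteTypeAt (Q : ℂ → ℂ → ℂ → ℂ) : Prop :=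
  ¬ ∀ᶠ p : ℂ × ℂ in 𝓝 0, Q p.1 p.2 0 = 0

/-- `q_{αμ}(χ) = ∂_z^α ∂_τ^μ Q(0, χ, 0)`. -/
def qd (Q : ℂ → ℂ → ℂ → ℂ) (α μ : ℕ) (χ : ℂ) : ℂ :=
  deriv^[α] (fun z => deriv^[μ] (fun τ => Q z χ τ) 0) 0

/-- The hypersurface (germ) defined by `Q` as a subset of `ℂ²`. -/
def MSet (Q : ℂ → ℂ → ℂ → ℂ) : Set (ℂ × ℂ) := {p | p.2 = Q p.1 (cj p.1) (cj p.2)}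

/-- The power series of the factor `g` in `f v - f (v - φ v • e) = φ v * g v`, obtained
by telescoping each homogeneous term. -/
def hadamardSeries {E : Type*} [NormedAddCommGroup E] [NormedSpace ℂ E]
    (p : FormalMultilinearSeries ℂ E ℂ) (π : E →L[ℂ] E) (e : E) :
    FormalMultilinearSeries ℂ E ℂ := fun n =>
  ∑ k : Fin (n + 1), ((p (n + 1)).curryMid k e).compContinuousLinearMap
    (fun i : Fin n => if i.castSucc < k then π else ContinuousLinearMap.id ℂ E)

lemma norm_hadamardSeries_le {E : Type*} [NormedAddCommGroup E] [NormedSpace ℂ E]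
    (p : FormalMultilinearSeries ℂ E ℂ) (π : E →L[ℂ] E) (e : E) (n : ℕ) :
    ‖hadamardSeries p π e n‖ ≤ (n + 1) * (‖p (n + 1)‖ * ‖e‖ * (1 + ‖π‖) ^ n) := by
  have key : ∀ k : Fin (n + 1), ‖((p (n + 1)).curryMid k e).compContinuousLinearMap
      (fun i : Fin n => if i.castSucc < k then π else ContinuousLinearMap.id ℂ E)‖
      ≤ ‖p (n + 1)‖ * ‖e‖ * (1 + ‖π‖) ^ n := by
    intro k
    refine (ContinuousMultilinearMap.norm_compContinuousLinearMap_le _ _).trans ?_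
    have h1 : ‖(p (n + 1)).curryMid k e‖ ≤ ‖p (n + 1)‖ * ‖e‖ := by
      refine (((p (n + 1)).curryMid k).le_opNorm e).trans ?_
      rw [ContinuousMultilinearMap.norm_curryMid]
    refine mul_le_mul h1 ?_ (Finset.prod_nonneg fun _ _ => norm_nonneg _) (by positivity)
    calc _ ≤ ∏ i : Fin n, (1 + ‖π‖) := by
          refine Finset.prod_le_prod (fun _ _ => norm_nonneg _) fun i _ => ?_
          split_ifs
          · linarith
          · linarith [ContinuousLinearMap.norm_id_le (𝕜 := ℂ) (E := E), norm_nonneg π]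
      _ = _ := by simp
  calc _ ≤ ∑ k : Fin (n + 1), ‖p (n + 1)‖ * ‖e‖ * (1 + ‖π‖) ^ n :=
        norm_sum_le_of_le _ fun k _ => key k
    _ = _ := by simp

lemma hadamardSeries_radius_pos {E : Type*} [NormedAddCommGroup E] [NormedSpace ℂ E]
    (p : FormalMultilinearSeries ℂ E ℂ) (hp : 0 < p.radius) (π : E →L[ℂ] E) (e : E) :
    0 < (hadamardSeries p π e).radius := by
  obtain ⟨C, r, hC, hr, hb⟩ := p.le_mul_pow_of_radius_pos hp
  set M := 2 * r * (1 + ‖π‖) with hM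
  have hMpos : 0 < M := by positivity
  have hle := (hadamardSeries p π e).le_radius_of_bound (C * r * ‖e‖)
    (r := ⟨M⁻¹, by positivity⟩) (by
    intro n
    have h2 : ((n : ℝ) + 1) ≤ 2 ^ n := by exact_mod_cast Nat.lt_two_pow_self (n := n)
    calc _ ≤ ((n + 1) * (‖p (n + 1)‖ * ‖e‖ * (1 + ‖π‖) ^ n)) * (M⁻¹) ^ n :=
          mul_le_mul_of_nonneg_right (norm_hadamardSeries_le p π e n) (pow_nonneg (by positivity) n)
      _ ≤ (2 ^ n * ((C * r ^ (n + 1)) * ‖e‖ * (1 + ‖π‖) ^ n)) * (M⁻¹) ^ n := by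
          gcongr
          exact hb _
      _ = C * r * ‖e‖ * (M ^ n * M⁻¹ ^ n) := by rw [hM, mul_pow, mul_pow]; ring
      _ = C * r * ‖e‖ := by rw [← mul_pow, mul_inv_cancel₀ hMpos.ne']; simp)
  refine lt_of_lt_of_le ?_ hle
  exact ENNReal.coe_pos.2 (show (0 : ℝ) < M⁻¹ by positivity)

lemma hadamardSeries_apply {E : Type*} [NormedAddCommGroup E] [NormedSpace ℂ E]
    (p : FormalMultilinearSeries ℂ E ℂ) (π : E →L[ℂ] E) (e v : E) (c : ℂ) (hv : v - π v = c • e)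
    (n : ℕ) :
    c * hadamardSeries p π e n (fun _ => v) =
      p (n + 1) (fun _ => v) - p (n + 1) (fun _ => π v) := by
  set a : ℕ → Fin (n + 1) → E := fun k i => if (i : ℕ) < k then π v else v with ha
  have tel : ∀ k : Fin (n + 1), c * ((p (n + 1)).curryMid k e).compContinuousLinearMap
      (fun i : Fin n => if i.castSucc < k then π else ContinuousLinearMap.id ℂ E) (fun _ => v)
      = p (n + 1) (a k) - p (n + 1) (a (k + 1)) := by
    intro k
    have e1 : a k = Function.update (a k) k v := by
      rw [eq_comm, Function.update_eq_self_iff]; simp [ha]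
    have e2 : a (k + 1) = Function.update (a k) k (π v) := by
      ext i
      by_cases hik : i = k
      · subst hik; simp [ha]
      · have : (i : ℕ) ≠ k := fun h => hik (Fin.ext h)
        have h3 : ((i : ℕ) < k + 1) ↔ (i : ℕ) < k := by omega
        simp only [ha, Function.update_of_ne hik, h3]
    rw [e2]
    nth_rw 1 [e1]
    rw [← ContinuousMultilinearMap.map_update_sub, hv, ContinuousMultilinearMap.map_update_smul,
      smul_eq_mul, ContinuousMultilinearMap.compContinuousLinearMap_apply,
      ContinuousMultilinearMap.curryMid_apply]
    congr 2
    rw [Fin.insertNth_eq_iff]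
    refine ⟨by simp, ?_⟩
    ext i
    rw [Fin.removeNth_apply, Function.update_of_ne (Fin.succAbove_ne k i)]
    by_cases hik : i.castSucc < k
    · simp only [ha, hik, if_true, Fin.succAbove_of_castSucc_lt _ _ hik]
      rw [if_pos (by simpa [Fin.lt_def] using hik)]
    · simp only [ha, hik, if_false, Fin.succAbove_of_le_castSucc _ _ (not_lt.1 hik)]
      rw [if_neg (by simp [Fin.lt_def] at hik ⊢; omega)]; simp
  rw [hadamardSeries, _root_.sum_apply, Finset.mul_sum,
    Finset.sum_congr rfl fun k _ => tel k,
    Fin.sum_univ_eq_sum_range (fun k => p (n + 1) (a k) - p (n + 1) (a (k + 1))),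
    Finset.sum_range_sub']
  congr 2
  ext i
  have := i.is_lt
  simp only [ha, if_pos this]

/-- The Hadamard lemma: an analytic function can be divided by the linear form `φ`, up to its
value along the projection `v ↦ v - φ v • e`. -/
lemma AnalyticAt.exists_hadamard {E : Type*} [NormedAddCommGroup E] [NormedSpace ℂ E]
    {f : E → ℂ} (hf : AnalyticAt ℂ f 0) (φ : E →L[ℂ] ℂ) (e : E) :
    ∃ g : E → ℂ, AnalyticAt ℂ g 0 ∧ ∀ᶠ v in 𝓝 0, f v - f (v - φ v • e) = φ v * g v := by
  obtain ⟨p, hp⟩ := hf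
  set π : E →L[ℂ] E := ContinuousLinearMap.id ℂ E - φ.smulRight e with hπ
  have hrad := hadamardSeries_radius_pos p hp.radius_pos π e
  have hg := (hadamardSeries p π e).hasFPowerSeriesOnBall hrad
  refine ⟨(hadamardSeries p π e).sum, hg.analyticAt, ?_⟩
  have hS := hp.eventually_hasSum
  have hc : Tendsto π (𝓝 0) (𝓝 0) := by simpa using π.continuous.tendsto 0
  filter_upwards [hS, hc.eventually hS, hg.hasFPowerSeriesAt.eventually_hasSum] with v h1 h2 h3
  have hπv : v - φ v • e = π v := by simp [hπ]
  simp only [zero_add] at h1 h2 h3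
  have h4 := (h3.mul_left (φ v))
  simp only [hadamardSeries_apply p π e v (φ v) (by simp [hπ])] at h4
  have h5 := h1.sub h2
  rw [← hasSum_nat_add_iff' 1] at h5
  have h6 : p 0 (fun _ => v) - p 0 (fun _ => π v) = 0 := by
    rw [Subsingleton.elim (fun _ : Fin 0 => v) (fun _ => π v), sub_self]
  simp only [Finset.range_one, Finset.sum_singleton, h6, sub_zero] at h5
  rw [hπv]
  exact h5.unique h4

lemma AnalyticAt.comp_continuousLinearMap_zero {E E' : Type*} [NormedAddCommGroup E]
    [NormedSpace ℂ E] [NormedAddCommGroup E'] [NormedSpace ℂ E'] {f : E' → ℂ}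
    (hf : AnalyticAt ℂ f 0) (u : E →L[ℂ] E') : AnalyticAt ℂ (fun v => f (u v)) 0 :=
  AnalyticAt.fun_comp (by simpa using hf) (u.analyticAt 0)

lemma eventually_eq_zero_of_ne {E : Type*} [NormedAddCommGroup E] [NormedSpace ℂ E]
    {h : E → ℂ} (hh : AnalyticAt ℂ h 0) (φ : E →L[ℂ] ℂ) {e : E} (he : φ e ≠ 0)
    (h0 : ∀ᶠ v in 𝓝 0, φ v ≠ 0 → h v = 0) : ∀ᶠ v in 𝓝 0, h v = 0 := by
  filter_upwards [h0.eventually_nhds, hh.eventually_analyticAt] with v hv hav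
  by_contra hne
  have hφ : ∀ᶠ w in 𝓝 v, φ w = 0 := by
    filter_upwards [hv, hav.continuousAt.eventually_ne hne] with w hw hw'
    by_contra hc
    exact hw' (hw hc)
  have hcont : Tendsto (fun s : ℂ => v + s • e) (𝓝[≠] 0) (𝓝 v) := by
    have : ContinuousAt (fun s : ℂ => v + s • e) 0 := by fun_prop
    simpa using this.tendsto.mono_left nhdsWithin_le_nhds
  obtain ⟨s, hs, hs0⟩ := ((hcont.eventually hφ).and self_mem_nhdsWithin).exists
  have hv0 := hφ.self_of_nhds
  simp [hv0, he] at hs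
  exact hs0 hs

/-- An analytic function vanishing to infinite order at `0` along every line is zero. -/
lemma eventually_eq_zero_of_lines {E : Type*} [NormedAddCommGroup E] [NormedSpace ℂ E]
    {f : E → ℂ} (hf : AnalyticAt ℂ f 0)
    (h0 : ∀ v : E, ∀ᶠ s : ℂ in 𝓝 0, f (s • v) = 0) : ∀ᶠ v in 𝓝 0, f v = 0 := by
  obtain ⟨ε, hε, hball⟩ := Metric.eventually_nhds_iff_ball.1 hf.eventually_analyticAt
  refine Metric.eventually_nhds_iff_ball.2 ⟨ε, hε, fun v hv => ?_⟩
  set U : Set ℂ := (fun s : ℂ => s • v) ⁻¹' Metric.ball 0 ε with hU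
  have hconv : Convex ℝ U := by
    have := (convex_ball (0 : E) ε).is_linear_preimage (f := fun s : ℂ => s • v)
      ⟨fun x y => add_smul x y v, fun c x => smul_assoc c x v⟩
    exact this
  have hana : AnalyticOnNhd ℂ (fun s : ℂ => f (s • v)) U := by
    intro s hs
    refine AnalyticAt.fun_comp (g := f) (f := fun s : ℂ => s • v) (hball _ hs) ?_
    exact analyticAt_id.smul analyticAt_const
  have := hana.eqOn_zero_of_preconnected_of_eventuallyEq_zero hconv.isPreconnected
    (z₀ := 0) (by simpa [hU] using hε) (h0 v)
  have h1 := this (x := 1) (by simpa [hU] using hv)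
  simpa using h1

/-- A nonzero analytic germ can be divided by a maximal power of the linear form `φ`. -/
lemma AnalyticAt.exists_eq_pow_mul {E : Type*} [NormedAddCommGroup E] [NormedSpace ℂ E]
    {f : E → ℂ} (hf : AnalyticAt ℂ f 0) (hne : ¬ ∀ᶠ v in 𝓝 0, f v = 0)
    (φ : E →L[ℂ] ℂ) (e : E) :
    ∃ (m : ℕ) (g : E → ℂ), AnalyticAt ℂ g 0 ∧ (∀ᶠ v in 𝓝 0, f v = φ v ^ m * g v) ∧
      ¬ ∀ᶠ v in 𝓝 0, g (v - φ v • e) = 0 := by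
  by_contra! hcon
  have hall : ∀ m : ℕ, ∃ g : E → ℂ, AnalyticAt ℂ g 0 ∧ ∀ᶠ v in 𝓝 0, f v = φ v ^ m * g v := by
    intro m
    induction m with
    | zero => exact ⟨f, hf, by simp⟩
    | succ m ih =>
      obtain ⟨g, hg, hfg⟩ := ih
      have h0 := hcon m g hg hfg
      obtain ⟨k, hk, hgk⟩ := hg.exists_hadamard φ e
      refine ⟨k, hk, ?_⟩
      filter_upwards [hfg, h0, hgk] with v h1 h2 h3
      rw [h2, sub_zero] at h3
      rw [h1, h3]; ring
  refine hne (eventually_eq_zero_of_lines hf fun v => ?_)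
  set u : ℂ →L[ℂ] E := ContinuousLinearMap.toSpanSingleton ℂ v with hu
  have huv : ∀ s : ℂ, u s = s • v := fun s => by simp [hu]
  have hana : AnalyticAt ℂ (fun s : ℂ => f (s • v)) 0 := by
    simpa only [huv] using hf.comp_continuousLinearMap_zero u
  rw [← analyticOrderAt_eq_top, ENat.eq_top_iff_forall_ge]
  intro m
  obtain ⟨g, hg, hfg⟩ := hall m
  rw [natCast_le_analyticOrderAt hana]
  refine ⟨fun s => φ v ^ m * g (u s), analyticAt_const.mul (hg.comp_continuousLinearMap_zero u), ?_⟩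
  have hc : Tendsto u (𝓝 0) (𝓝 0) := by simpa using u.continuous.tendsto 0
  filter_upwards [hc.eventually hfg] with s hs
  rw [huv] at hs
  rw [hs, huv]
  simp [mul_pow]
  ring

/-- Leading-term decomposition of a germ `R(z,χ,τ)` divisible by `χ`: first in `τ`, then in `χ`. -/
lemma exists_leading_term {R : ℂ × ℂ × ℂ → ℂ} (hR : AnalyticAt ℂ R 0)
    (hne : ¬ ∀ᶠ p in 𝓝 0, R p = 0) (hχ : ∀ᶠ p : ℂ × ℂ in 𝓝 0, R (p.1, 0, p.2) = 0) :
    ∃ (m l : ℕ) (q : ℂ → ℂ) (k₁ : ℂ × ℂ → ℂ) (k₂ : ℂ × ℂ × ℂ → ℂ), 1 ≤ l ∧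
      AnalyticAt ℂ q 0 ∧ AnalyticAt ℂ k₁ 0 ∧ AnalyticAt ℂ k₂ 0 ∧
      (¬ ∀ᶠ z in 𝓝 0, q z = 0) ∧
      ∀ᶠ p : ℂ × ℂ × ℂ in 𝓝 0, R p = p.2.2 ^ m * p.2.1 ^ l * (q p.1 + p.2.1 * k₁ (p.1, p.2.1)) +
        p.2.2 ^ (m + 1) * p.2.1 * k₂ p := by
  let fst₂ := ContinuousLinearMap.fst ℂ ℂ ℂ
  let snd₂ := ContinuousLinearMap.snd ℂ ℂ ℂ
  let pz := ContinuousLinearMap.fst ℂ ℂ (ℂ × ℂ)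
  let pχ : ℂ × ℂ × ℂ →L[ℂ] ℂ := fst₂.comp (ContinuousLinearMap.snd ℂ ℂ (ℂ × ℂ))
  let pτ : ℂ × ℂ × ℂ →L[ℂ] ℂ := snd₂.comp (ContinuousLinearMap.snd ℂ ℂ (ℂ × ℂ))
  let ιzτ : ℂ × ℂ →L[ℂ] ℂ × ℂ × ℂ := fst₂.prod ((0 : ℂ × ℂ →L[ℂ] ℂ).prod snd₂)
  let ιzχ : ℂ × ℂ →L[ℂ] ℂ × ℂ × ℂ := fst₂.prod (snd₂.prod 0)
  let ιz : ℂ →L[ℂ] ℂ × ℂ := ContinuousLinearMap.inl ℂ ℂ ℂ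
  let πzχ : ℂ × ℂ × ℂ →L[ℂ] ℂ × ℂ := pz.prod pχ
  let πzτ : ℂ × ℂ × ℂ →L[ℂ] ℂ × ℂ := pz.prod pτ
  have lim : ∀ {E E' : Type} [NormedAddCommGroup E] [NormedSpace ℂ E] [NormedAddCommGroup E']
      [NormedSpace ℂ E'] (u : E →L[ℂ] E'), Tendsto u (𝓝 0) (𝓝 0) := fun u => by
    simpa using u.continuous.tendsto 0
  obtain ⟨m, g, hg, hRg, hgne⟩ := hR.exists_eq_pow_mul hne pτ (0, 0, 1)
  obtain ⟨k, hk, hgk⟩ := hg.exists_hadamard pτ (0, 0, 1)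
  have hπ : ∀ v : ℂ × ℂ × ℂ, v - pτ v • ((0, 0, 1) : ℂ × ℂ × ℂ) = ιzχ (πzχ v) := fun v => by
    ext <;> simp [pτ, ιzχ, πzχ, pz, pχ, fst₂, snd₂]
  simp only [hπ] at hgne hgk
  have hg0 := hg.comp_continuousLinearMap_zero ιzχ
  have hg0ne : ¬ ∀ᶠ p in 𝓝 0, g (ιzχ p) = 0 := fun h => hgne ((lim πzχ).eventually h)
  obtain ⟨l, g₁, hg₁, hgg₁, hg₁ne⟩ := hg0.exists_eq_pow_mul hg0ne snd₂ (0, 1)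
  obtain ⟨k₁, hk₁, hgk₁⟩ := hg₁.exists_hadamard snd₂ (0, 1)
  have hπ₂ : ∀ v : ℂ × ℂ, v - snd₂ v • ((0, 1) : ℂ × ℂ) = ιz (fst₂ v) := fun v => by
    ext <;> simp [ιz, fst₂, snd₂]
  simp only [hπ₂] at hg₁ne hgk₁
  have hg_zero : ∀ᶠ p : ℂ × ℂ in 𝓝 0, g (ιzτ p) = 0 := by
    refine eventually_eq_zero_of_ne (hg.comp_continuousLinearMap_zero ιzτ) snd₂ (e := (0, 1))
      (by simp [snd₂]) ?_
    filter_upwards [hχ, (lim ιzτ).eventually hRg] with p h1 h2 h3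
    have : R (ιzτ p) = 0 := h1
    rw [this] at h2
    exact (mul_eq_zero.1 h2.symm).resolve_left (pow_ne_zero _ h3)
  have hk_zero : ∀ᶠ p : ℂ × ℂ in 𝓝 0, k (ιzτ p) = 0 := by
    refine eventually_eq_zero_of_ne (hk.comp_continuousLinearMap_zero ιzτ) snd₂ (e := (0, 1))
      (by simp [snd₂]) ?_
    have hc : Tendsto (fun p : ℂ × ℂ => ((p.1, 0) : ℂ × ℂ)) (𝓝 0) (𝓝 0) :=
      lim (ιz.comp fst₂)
    filter_upwards [hg_zero, hc.eventually hg_zero, (lim ιzτ).eventually hgk] with p h1 h2 h3 h4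
    have e1 : ιzχ (πzχ (ιzτ p)) = ιzτ (p.1, 0) := by
      ext <;> simp [ιzτ, ιzχ, πzχ, pz, pχ, fst₂, snd₂]
    rw [e1, h1, h2, sub_zero] at h3
    exact (mul_eq_zero.1 h3.symm).resolve_left h4
  obtain ⟨k₂, hk₂, hkk₂⟩ := hk.exists_hadamard pχ (0, 1, 0)
  have hπ₃ : ∀ v : ℂ × ℂ × ℂ, v - pχ v • ((0, 1, 0) : ℂ × ℂ × ℂ) = ιzτ (πzτ v) := fun v => by
    ext <;> simp [ιzτ, πzτ, pτ, pz, pχ, fst₂, snd₂]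
  simp only [hπ₃] at hkk₂
  have hqne : ¬ ∀ᶠ z in 𝓝 0, g₁ (ιz z) = 0 := fun h => hg₁ne ((lim fst₂).eventually h)
  refine ⟨m, l, fun z => g₁ (ιz z), k₁, k₂, ?_, hg₁.comp_continuousLinearMap_zero ιz, hk₁, hk₂,
    hqne, ?_⟩
  · by_contra hl
    have hl0 : l = 0 := by omega
    apply hqne
    filter_upwards [(lim ιz).eventually hg_zero, (lim ιz).eventually hgg₁] with z h1 h2
    have e1 : ιzχ (ιz z) = ιzτ (ιz z) := by
      ext <;> simp [ιzτ, ιzχ, ιz, fst₂, snd₂]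
    rw [e1, h1, hl0] at h2
    simpa using h2.symm
  · filter_upwards [hRg, hgk, hkk₂, (lim πzτ).eventually hk_zero, (lim πzχ).eventually hgg₁,
      (lim πzχ).eventually hgk₁] with p h1 h2 h3 h4 h5 h6
    rw [h4, sub_zero] at h3
    rw [h5, h3] at h2
    rw [h1]
    have e2 : fst₂ (πzχ p) = p.1 := rfl
    have e3 : snd₂ (πzχ p) = p.2.1 := rfl
    have e4 : πzχ p = (p.1, p.2.1) := rfl
    have e5 : pτ p = p.2.2 := rfl
    have e6 : pχ p = p.2.1 := rfl
    rw [e2, e3] at h6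
    rw [e3, e5, e6] at h2
    rw [e5, ← e4]
    linear_combination p.2.2 ^ m * h2 + p.2.2 ^ m * p.2.1 ^ l * h6

/-- The decomposition of `exists_leading_term` determines the leading behaviour of `R` along
curves with `χ ∼ x T`, `τ ∼ T ^ l`. -/
lemma tendsto_leading_term {R k₂ : ℂ × ℂ × ℂ → ℂ} {k₁ : ℂ × ℂ → ℂ} {q : ℂ → ℂ} {m l : ℕ}
    {L : Filter ℂ} (hL : L ≤ 𝓝[≠] 0) (hl : 1 ≤ l) (hq : AnalyticAt ℂ q 0)
    (hk₁ : AnalyticAt ℂ k₁ 0) (hk₂ : AnalyticAt ℂ k₂ 0)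
    (hR : ∀ᶠ p : ℂ × ℂ × ℂ in 𝓝 0, R p =
      p.2.2 ^ m * p.2.1 ^ l * (q p.1 + p.2.1 * k₁ (p.1, p.2.1)) +
        p.2.2 ^ (m + 1) * p.2.1 * k₂ p) :
    ∀ᶠ z in 𝓝 (0 : ℂ), ∀ (Z X Y : ℂ → ℂ) (x : ℂ), Tendsto Z L (𝓝 z) →
      Tendsto (fun T => X T / T) L (𝓝 x) → Tendsto (fun T => Y T / T ^ l) L (𝓝 1) →
      Tendsto (fun T => R (Z T, X T, Y T) / T ^ (l * m + l)) L (𝓝 (x ^ l * q z)) := by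
  have c3 : Tendsto (fun z : ℂ => ((z, 0, 0) : ℂ × ℂ × ℂ)) (𝓝 0) (𝓝 0) :=
    Continuous.tendsto' (by fun_prop) _ _ rfl
  have c2 : Tendsto (fun z : ℂ => ((z, 0) : ℂ × ℂ)) (𝓝 0) (𝓝 0) :=
    Continuous.tendsto' (by fun_prop) _ _ rfl
  filter_upwards [c3.eventually hR.eventually_nhds, hq.eventually_analyticAt,
    c2.eventually hk₁.eventually_analyticAt, c3.eventually hk₂.eventually_analyticAt]
    with z h1 h2 h3 h4 Z X Y x hZ hX hY
  have hT : Tendsto (fun T : ℂ => T) L (𝓝 0) := hL.trans nhdsWithin_le_nhds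
  have hT0 : ∀ᶠ T in L, T ≠ 0 := hL self_mem_nhdsWithin
  have hX0 : Tendsto X L (𝓝 0) := by
    have := hX.mul hT
    rw [mul_zero] at this
    exact this.congr' (hT0.mono fun T h => div_mul_cancel₀ _ h)
  have hY0 : Tendsto Y L (𝓝 0) := by
    have := hY.mul (hT.pow l)
    rw [zero_pow (by omega), mul_zero] at this
    exact this.congr' (hT0.mono fun T h => div_mul_cancel₀ _ (pow_ne_zero _ h))
  have hp3 : Tendsto (fun T => (Z T, X T, Y T)) L (𝓝 (z, 0, 0)) :=
    hZ.prodMk_nhds (hX0.prodMk_nhds hY0)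
  have hp2 : Tendsto (fun T => (Z T, X T)) L (𝓝 (z, 0)) := hZ.prodMk_nhds hX0
  have e1 := h2.continuousAt.tendsto.comp hZ
  have e2 := h3.continuousAt.tendsto.comp hp2
  have e3 := h4.continuousAt.tendsto.comp hp3
  have key := (((hY.pow m).mul (hX.pow l)).mul (e1.add (hX0.mul e2))).add
    ((((hY.pow (m + 1)).mul hX).mul hT).mul e3)
  have lim_eq : (1 : ℂ) ^ m * x ^ l * (q z + 0 * k₁ (z, 0)) +
      1 ^ (m + 1) * x * 0 * k₂ (z, 0, 0) = x ^ l * q z := by simp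
  rw [lim_eq] at key
  refine key.congr' ?_
  filter_upwards [hT0, hp3.eventually h1] with T hT0 hRT
  simp only [Function.comp]
  rw [hRT]
  have hs0 : T ^ l ≠ 0 := pow_ne_zero _ hT0
  simp only [div_pow, pow_add, pow_mul, pow_one]
  generalize T ^ l = s at hs0
  field_simp

lemma tendsto_div_of_hasDerivAt {f : ℂ → ℂ} {d : ℂ} (hf : HasDerivAt f d 0) (hf0 : f 0 = 0) :
    Tendsto (fun z => f z / z) (𝓝[≠] 0) (𝓝 d) := by
  refine (hasDerivAt_iff_tendsto_slope_zero.1 hf).congr fun z => ?_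
  simp [hf0, div_eq_inv_mul]

/-- A nonconstant germ is invariant under a germ tangent to the identity only if the latter
is the identity. -/
lemma eventually_eq_self_of_invariant {q f : ℂ → ℂ} (hq : AnalyticAt ℂ q 0) (hq0 : q 0 = 0)
    (hqne : ¬ ∀ᶠ z in 𝓝 0, q z = 0) (hf0 : f 0 = 0) (hf : HasDerivAt f 1 0)
    (hqf : ∀ᶠ z in 𝓝 0, q (f z) = q z) : ∀ᶠ z in 𝓝 0, f z = z := by
  obtain ⟨k, g, hg, hg0, hqg⟩ :=
    (hq.exists_eventuallyEq_pow_smul_nonzero_iff).2 hqne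
  simp only [sub_zero, smul_eq_mul] at hqg
  have hk : k ≠ 0 := by
    rintro rfl
    have := hqg.self_of_nhds
    rw [hq0, pow_zero, one_mul] at this
    exact hg0 this.symm
  have hft : Tendsto f (𝓝 0) (𝓝 0) := by simpa [hf0] using hf.continuousAt.tendsto
  have hr : Tendsto (fun z => f z / z) (𝓝[≠] 0) (𝓝 1) :=
    tendsto_div_of_hasDerivAt hf hf0
  have hsd := hg.hasStrictDerivAt.isBigO_sub
  have hpair : Tendsto (fun z => (f z, z)) (𝓝 (0 : ℂ)) (𝓝 (0, 0)) :=
    hft.prodMk_nhds tendsto_id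
  have hO := (hsd.comp_tendsto hpair).mono (nhdsWithin_le_nhds (s := {0}ᶜ))
  obtain ⟨C, hC⟩ := hO.bound
  -- the factor multiplying `(f z - z) z ^ (k - 1)` tends to `k g(0) ≠ 0`
  have hS : Tendsto (fun z => (∑ i ∈ Finset.range k, (f z / z) ^ i) * g (f z)) (𝓝[≠] 0)
      (𝓝 (k * g 0)) := by
    have h1 : Tendsto (fun z => ∑ i ∈ Finset.range k, (f z / z) ^ i) (𝓝[≠] 0)
        (𝓝 (∑ i ∈ Finset.range k, (1 : ℂ) ^ i)) := tendsto_finsetSum _ fun i _ => hr.pow i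
    simp only [one_pow, Finset.sum_const, Finset.card_range, nsmul_eq_mul, mul_one] at h1
    exact h1.mul (hg.continuousAt.tendsto.comp (hft.mono_left nhdsWithin_le_nhds))
  have hpos : 0 < ‖(k : ℂ) * g 0‖ := by
    rw [norm_pos_iff]; exact mul_ne_zero (Nat.cast_ne_zero.2 hk) hg0
  have hz : Tendsto (fun z : ℂ => ‖z‖ * C) (𝓝[≠] 0) (𝓝 0) := by
    have : Tendsto (fun z : ℂ => ‖z‖ * C) (𝓝 0) (𝓝 0) :=
      Continuous.tendsto' (by fun_prop) _ _ (by simp)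
    exact this.mono_left nhdsWithin_le_nhds
  have hlt := hz.eventually_lt hS.norm hpos
  have hpunct : ∀ᶠ z in 𝓝[≠] 0, f z = z := by
    filter_upwards [hlt, hC, nhdsWithin_le_nhds hqf, nhdsWithin_le_nhds hqg,
      nhdsWithin_le_nhds (hft.eventually hqg), self_mem_nhdsWithin] with z h1 h2 h3 h4 h5 hz0
    replace hz0 : z ≠ 0 := hz0
    by_contra hne
    have hne' : 0 < ‖f z - z‖ := norm_pos_iff.2 (sub_ne_zero.2 hne)
    simp only [Function.comp] at h2
    have hgeo : (f z / z - 1) * ∑ i ∈ Finset.range k, (f z / z) ^ i = (f z / z) ^ k - 1 := by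
      rw [mul_comm]; exact geom_sum_mul _ _
    set S := ∑ i ∈ Finset.range k, (f z / z) ^ i
    have hid : (f z - z) * (S * g (f z)) = - (z * (g (f z) - g z)) := by
      have e1 : (f z) ^ k * g (f z) = z ^ k * g z := by rw [← h5, ← h4, h3]
      have e2 : (f z) ^ k = z ^ k * (f z / z) ^ k := by rw [← mul_pow, mul_div_cancel₀ _ hz0]
      have e3 : f z = z * (f z / z) := by rw [mul_div_cancel₀ _ hz0]
      have e4 : (f z / z) ^ k * g (f z) = g z := by
        have : z ^ k * ((f z / z) ^ k * g (f z)) = z ^ k * g z := by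
          rw [← e1, ← mul_assoc, ← e2]
        exact mul_left_cancel₀ (pow_ne_zero _ hz0) this
      have e5 : (f z - z) * S = z * ((f z / z) ^ k - 1) := by
        rw [← hgeo]
        field_simp
      rw [← mul_assoc, e5]
      linear_combination z * e4
    have hn := congrArg norm hid
    rw [norm_mul (f z - z), norm_neg, norm_mul z] at hn
    have : ‖f z - z‖ * ‖S * g (f z)‖ ≤ ‖f z - z‖ * (‖z‖ * C) := by
      rw [hn]
      calc _ ≤ ‖z‖ * (C * ‖f z - z‖) := by gcongr
        _ = _ := by ring
    exact absurd (le_of_mul_le_mul_left this hne') (not_le.2 h1)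
  rw [eventually_nhdsWithin_iff] at hpunct
  filter_upwards [hpunct] with z hz
  by_cases h0 : z = 0
  · rw [h0, hf0]
  · exact hz h0

lemma hasFDerivAt_of_pd {F : ℂ → ℂ → ℂ} (hF : AnalyticAt ℂ (fun p : ℂ × ℂ => F p.1 p.2) 0) :
    HasFDerivAt (fun p : ℂ × ℂ => F p.1 p.2)
      (pd F 1 0 0 0 • ContinuousLinearMap.fst ℂ ℂ ℂ +
        pd F 0 1 0 0 • ContinuousLinearMap.snd ℂ ℂ ℂ) 0 := by
  have h := hF.differentiableAt.hasFDerivAt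
  set D := fderiv ℂ (fun p : ℂ × ℂ => F p.1 p.2) 0
  have c1 : HasDerivAt (fun z : ℂ => ((z, 0) : ℂ × ℂ)) (1, 0) 0 :=
    (hasDerivAt_id (0 : ℂ)).prodMk (hasDerivAt_const _ _)
  have c2 : HasDerivAt (fun z : ℂ => ((0, z) : ℂ × ℂ)) (0, 1) 0 :=
    (hasDerivAt_const _ _).prodMk (hasDerivAt_id (0 : ℂ))
  have d1 : pd F 1 0 0 0 = D (1, 0) :=
    (HasFDerivAt.comp_hasDerivAt (f := fun z : ℂ => ((z, 0) : ℂ × ℂ)) (0 : ℂ) h c1).deriv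
  have d2 : pd F 0 1 0 0 = D (0, 1) :=
    (HasFDerivAt.comp_hasDerivAt (f := fun z : ℂ => ((0, z) : ℂ × ℂ)) (0 : ℂ) h c2).deriv
  suffices hD : pd F 1 0 0 0 • ContinuousLinearMap.fst ℂ ℂ ℂ +
      pd F 0 1 0 0 • ContinuousLinearMap.snd ℂ ℂ ℂ = D by rwa [hD]
  refine ContinuousLinearMap.ext fun v => ?_
  have hv : v = v.1 • ((1, 0) : ℂ × ℂ) + v.2 • ((0, 1) : ℂ × ℂ) := by ext <;> simp
  conv_rhs => rw [hv, map_add, map_smul, map_smul]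
  simp [d1, d2, mul_comm]

lemma continuous_cj : Continuous cj := Complex.continuous_conj

/-- The filter of nonzero real numbers tending to `0` in `ℂ`. -/
def realPunctured : Filter ℂ := Filter.map (fun r : ℝ => (r : ℂ)) (𝓝[≠] 0)

instance : realPunctured.NeBot := inferInstanceAs (Filter.map _ _).NeBot

lemma realPunctured_le : realPunctured ≤ 𝓝[≠] 0 := by
  refine tendsto_nhdsWithin_iff.2 ⟨?_, ?_⟩
  · exact (Continuous.tendsto' Complex.continuous_ofReal _ _ (by simp)).mono_left
      nhdsWithin_le_nhds
  · filter_upwards [self_mem_nhdsWithin] with r hr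
    simpa using hr

lemma eventually_cj_eq_self : ∀ᶠ T in realPunctured, cj T = T := by
  simp [realPunctured, cj]

lemma tendsto_cj_div {f : ℂ → ℂ} {d : ℂ} {l : ℕ}
    (h : Tendsto (fun T => f T / T ^ l) realPunctured (𝓝 d)) :
    Tendsto (fun T => cj (f T) / T ^ l) realPunctured (𝓝 (cj d)) := by
  refine ((continuous_cj.tendsto d).comp h).congr' ?_
  filter_upwards [eventually_cj_eq_self] with T hT
  have : cj (f T / T ^ l) = cj (f T) / cj T ^ l := by simp [cj]
  rw [Function.comp, this, hT]

/-- Theorem 1.6: a local biholomorphism of `(ℂ²,0)` tangent to the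
identity which preserves a Levi-nonflat real-analytic hypersurface (given in normal
coordinates by `Q`) fixes pointwise the zero Segre variety `{w = 0}`. -/
theorem tangent_to_identity_fixes_segre
    (Q : ℂ → ℂ → ℂ → ℂ) (hQ : IsNormalCoord Q) (hLF : NotLeviFlat Q)
    (F G : ℂ → ℂ → ℂ) (h : SendsInto Q Q F G)
    (hFz : pd F 1 0 0 0 = 1) (hFw : pd F 0 1 0 0 = 0)
    (hGz : pd G 1 0 0 0 = 0) (hGw : pd G 0 1 0 0 = 1) :
    ∀ᶠ z : ℂ in 𝓝 0, F z 0 = z ∧ G z 0 = 0 := by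
  obtain ⟨hQa, hQz, hQχ, -⟩ := hQ
  obtain ⟨hFa, hGa, hF0, hG0, hM⟩ := h
  have hFd := hasFDerivAt_of_pd hFa
  have hGd := hasFDerivAt_of_pd hGa
  rw [hFz, hFw] at hFd
  rw [hGz, hGw] at hGd
  set R : ℂ × ℂ × ℂ → ℂ := fun p => Q p.1 p.2.1 p.2.2 - p.2.2 with hRdef
  have hRa : AnalyticAt ℂ R 0 :=
    hQa.sub ((ContinuousLinearMap.snd ℂ ℂ ℂ).comp
      (ContinuousLinearMap.snd ℂ ℂ (ℂ × ℂ)) |>.analyticAt 0)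
  have hRne : ¬ ∀ᶠ p in 𝓝 0, R p = 0 := fun hc => hLF (hc.mono fun p hp => sub_eq_zero.1 hp)
  obtain ⟨m, l, q, k₁, k₂, hl, hqa, hk₁, hk₂, hqne, hdec⟩ :=
    exists_leading_term hRa hRne (hQz.mono fun p hp => by simp [hRdef, hp])
  have hlead := tendsto_leading_term realPunctured_le hl hqa hk₁ hk₂ hdec
  set L := realPunctured
  have hLT : Tendsto (fun T : ℂ => T) L (𝓝 0) := realPunctured_le.trans nhdsWithin_le_nhds
  have hLne : ∀ᶠ T in L, T ≠ 0 := realPunctured_le self_mem_nhdsWithin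
  have hLs : Tendsto (fun T : ℂ => T ^ l) L (𝓝 0) := by
    simpa [show l ≠ 0 by omega] using hLT.pow l
  have hLs' : Tendsto (fun T : ℂ => T ^ l) L (𝓝[≠] 0) :=
    tendsto_nhdsWithin_iff.2 ⟨hLs, hLne.mono fun T hT => pow_ne_zero _ hT⟩
  have hTT : Tendsto (fun T : ℂ => T / T) L (𝓝 1) :=
    tendsto_const_nhds.congr' (hLne.mono fun T hT => (div_self hT).symm)
  have hss : Tendsto (fun T : ℂ => T ^ l / T ^ l) L (𝓝 1) :=
    tendsto_const_nhds.congr' (hLne.mono fun T hT => (div_self (pow_ne_zero _ hT)).symm)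
  have cj0 : cj 0 = 0 := by simp [cj]
  have cj1 : cj 1 = 1 := by simp [cj]
  -- first-order behaviour of `F` and `G` along the curves used below
  have c2 : HasDerivAt (fun z : ℂ => ((0, z) : ℂ × ℂ)) (0, 1) 0 :=
    (hasDerivAt_const _ _).prodMk (hasDerivAt_id (0 : ℂ))
  have c1 : HasDerivAt (fun z : ℂ => ((z, 0) : ℂ × ℂ)) (1, 0) 0 :=
    (hasDerivAt_id (0 : ℂ)).prodMk (hasDerivAt_const _ _)
  have hfder : HasDerivAt (fun z => F z 0) 1 0 := by
    simpa [Function.comp_def] using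
        HasFDerivAt.comp_hasDerivAt (f := fun z : ℂ => ((z, 0) : ℂ × ℂ)) (0 : ℂ) hFd c1
  have hF0s : Tendsto (fun T => F 0 (T ^ l) / T ^ l) L (𝓝 0) := by
    have : HasDerivAt (fun z => F 0 z) 0 0 := by
      simpa [Function.comp_def] using
        HasFDerivAt.comp_hasDerivAt (f := fun z : ℂ => ((0, z) : ℂ × ℂ)) (0 : ℂ) hFd c2
    exact (tendsto_div_of_hasDerivAt this hF0).comp hLs'
  have hG0s : Tendsto (fun T => G 0 (T ^ l) / T ^ l) L (𝓝 1) := by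
    have : HasDerivAt (fun z => G 0 z) 1 0 := by
      simpa [Function.comp_def] using
        HasFDerivAt.comp_hasDerivAt (f := fun z : ℂ => ((0, z) : ℂ × ℂ)) (0 : ℂ) hGd c2
    exact (tendsto_div_of_hasDerivAt this hG0).comp hLs'
  have hFTs : Tendsto (fun T => F T (T ^ l) / T) L (𝓝 1) := by
    have c3 : HasDerivAt (fun z : ℂ => ((z, z ^ l) : ℂ × ℂ)) (1, l * 0 ^ (l - 1)) 0 :=
      (hasDerivAt_id (0 : ℂ)).prodMk (hasDerivAt_pow l 0)
    have hFd' : HasFDerivAt (fun p : ℂ × ℂ => F p.1 p.2)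
        ((1 : ℂ) • ContinuousLinearMap.fst ℂ ℂ ℂ + (0 : ℂ) • ContinuousLinearMap.snd ℂ ℂ ℂ)
        ((fun z : ℂ => ((z, z ^ l) : ℂ × ℂ)) 0) := by
      have : ((fun z : ℂ => ((z, z ^ l) : ℂ × ℂ)) 0) = 0 := by
        simp [show l ≠ 0 by omega]
      rw [this]; exact hFd
    have : HasDerivAt (fun z => F z (z ^ l)) 1 0 := by
      simpa [Function.comp_def] using HasFDerivAt.comp_hasDerivAt (0 : ℂ) hFd' c3
    exact (tendsto_div_of_hasDerivAt this (by simp [show l ≠ 0 by omega, hF0])).mono_left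
      realPunctured_le
  have hcjF0 : Tendsto (fun T => cj (F 0 (T ^ l)) / T) L (𝓝 0) := by
    have := tendsto_cj_div hF0s
    rw [cj0] at this
    have := this.mul (hLT.pow (l - 1))
    rw [zero_mul] at this
    refine this.congr' (hLne.mono fun T hT => ?_)
    obtain ⟨j, rfl⟩ : ∃ j, l = j + 1 := ⟨l - 1, by omega⟩
    simp only [add_tsub_cancel_right, pow_succ]
    field_simp
  have hcjG0 : Tendsto (fun T => cj (G 0 (T ^ l)) / T ^ l) L (𝓝 1) := by
    simpa only [cj1] using tendsto_cj_div hG0s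
  have hcjFT : Tendsto (fun T => cj (F T (T ^ l)) / T) L (𝓝 1) := by
    have := tendsto_cj_div (f := fun T => F T (T ^ l)) (l := 1) (by simpa using hFTs)
    simpa only [cj1, pow_one] using this
  have c3 : Tendsto (fun z : ℂ => ((z, 0, 0) : ℂ × ℂ × ℂ)) (𝓝 0) (𝓝 0) :=
    Continuous.tendsto' (by fun_prop) _ _ rfl
  have c2' : Tendsto (fun z : ℂ => ((z, 0) : ℂ × ℂ)) (𝓝 0) (𝓝 0) :=
    Continuous.tendsto' (by fun_prop) _ _ rfl
  have hft : Tendsto (fun z => F z 0) (𝓝 0) (𝓝 0) := by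
    simpa [hF0] using hfder.continuousAt.tendsto
  -- `G(·, τ)` agrees with the conjugate of `G(0, τ)` to high order
  have hGlead : ∀ᶠ z in 𝓝 (0 : ℂ), ∀ Z : ℂ → ℂ, Tendsto Z L (𝓝 z) →
      Tendsto (fun T => (G (Z T) (T ^ l) - cj (G 0 (T ^ l))) / T ^ (l * m + l)) L (𝓝 0) := by
    filter_upwards [hft.eventually hlead, c3.eventually hM.eventually_nhds,
      c2'.eventually hQz.eventually_nhds, c2'.eventually hFa.eventually_analyticAt]
      with z h1 h2 h3 h4 Z hZ
    have hZF : Tendsto (fun T => F (Z T) (T ^ l)) L (𝓝 (F z 0)) :=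
      h4.continuousAt.tendsto.comp (hZ.prodMk_nhds hLs)
    have := h1 _ _ _ 0 hZF hcjF0 hcjG0
    rw [zero_pow (by omega), zero_mul] at this
    have t3 : Tendsto (fun T => (Z T, (0 : ℂ), T ^ l)) L (𝓝 (z, 0, 0)) :=
      hZ.prodMk_nhds (tendsto_const_nhds.prodMk_nhds hLs)
    refine this.congr' ?_
    filter_upwards [t3.eventually h2, (hZ.prodMk_nhds hLs).eventually h3,
      eventually_cj_eq_self] with T e1 e2 e3
    have e4 : cj (T ^ l) = T ^ l := by
      have : cj (T ^ l) = cj T ^ l := by simp [cj]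
      rw [this, e3]
    simp only [e2, e4, cj0] at e1
    simp only [hRdef, e1]
  have hdivs : ∀ f : ℂ → ℂ, Tendsto (fun T => f T / T ^ (l * m + l)) L (𝓝 0) →
      Tendsto (fun T => f T / T ^ l) L (𝓝 0) := fun f hf => by
    have := hf.mul (hLT.pow (l * m))
    rw [zero_mul] at this
    refine this.congr' (hLne.mono fun T hT => ?_)
    rw [pow_add]
    field_simp
  have hGT := hGlead.self_of_nhds _ hLT
  have hcjGT : Tendsto (fun T => cj (G T (T ^ l)) / T ^ l) L (𝓝 1) := by
    have h1 := (hdivs _ hGT).add hcjG0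
    rw [zero_add] at h1
    have := tendsto_cj_div (f := fun T => G T (T ^ l))
      (h1.congr fun T => by rw [← add_div, sub_add_cancel])
    simpa only [cj1] using this
  have hq0 : q 0 = 0 := by
    have h1 := hlead.self_of_nhds (fun _ => 0) (fun T => T) (fun T => T ^ l) 1
      tendsto_const_nhds hTT hss
    rw [one_pow, one_mul] at h1
    refine tendsto_nhds_unique h1 (tendsto_const_nhds.congr' ?_)
    have t2 : Tendsto (fun T : ℂ => (T, T ^ l)) L (𝓝 0) := hLT.prodMk_nhds hLs
    filter_upwards [t2.eventually hQχ] with T hT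
    simp [hRdef, hT]
  have hGz0 : ∀ᶠ z : ℂ in 𝓝 0, G z 0 = 0 := by
    filter_upwards [c3.eventually hM, c2'.eventually hQz, (c2'.comp hft).eventually hQz]
      with z h1 h2 h3
    replace h3 : Q (F z 0) 0 0 = 0 := h3
    simpa only [h2, cj0, hF0, hG0, h3] using h1
  have hqf : ∀ᶠ z in 𝓝 (0 : ℂ), q (F z 0) = q z := by
    filter_upwards [hft.eventually hlead, hlead, hGlead, hGz0, c3.eventually hM.eventually_nhds,
      c2'.eventually hQz, c3.eventually hQa.eventually_analyticAt,
      c2'.eventually hFa.eventually_analyticAt, c2'.eventually hGa.eventually_analyticAt]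
      with z h1 h2 h3 h4 h5 h6 h7 h8 h9
    have t3 : Tendsto (fun T => (z, T, T ^ l)) L (𝓝 (z, 0, 0)) :=
      tendsto_const_nhds.prodMk_nhds (hLT.prodMk_nhds hLs)
    have hQv : Tendsto (fun T => Q z T (T ^ l)) L (𝓝 0) := by
      have := h7.continuousAt.tendsto.comp t3
      simpa only [Function.comp_def, h6] using this
    have hFQ : Tendsto (fun T => F z (Q z T (T ^ l))) L (𝓝 (F z 0)) :=
      h8.continuousAt.tendsto.comp (tendsto_const_nhds.prodMk_nhds hQv)
    have rhs := h1 _ _ _ 1 hFQ hcjFT hcjGT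
    have hQs := h2 (fun _ => z) (fun T => T) (fun T => T ^ l) 1 tendsto_const_nhds hTT hss
    rw [one_pow, one_mul] at rhs hQs
    have hGzT := h3 (fun _ => z) tendsto_const_nhds
    have hGan : AnalyticAt ℂ (G z) 0 :=
      AnalyticAt.fun_comp (g := fun p : ℂ × ℂ => G p.1 p.2) (f := fun w : ℂ => (z, w)) h9
        (analyticAt_const.prod analyticAt_id)
    have hd1 : deriv (G z) 0 = 1 := by
      have a1 := (tendsto_div_of_hasDerivAt hGan.differentiableAt.hasDerivAt h4).comp hLs'
      have a2 := (hdivs _ hGzT).add hcjG0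
      rw [zero_add] at a2
      exact tendsto_nhds_unique a1 (a2.congr fun T => by
        rw [← add_div, sub_add_cancel]; rfl)
    have hstr := hGan.hasStrictDerivAt
    rw [hd1] at hstr
    have ho := hstr.isLittleO.comp_tendsto (hQv.prodMk_nhds hLs)
    have hoK : Tendsto (fun T => (G z (Q z T (T ^ l)) - G z (T ^ l) - (Q z T (T ^ l) - T ^ l)) /
        T ^ (l * m + l)) L (𝓝 0) := by
      have hO : (fun T => Q z T (T ^ l) - T ^ l) =O[L] fun T => T ^ (l * m + l) :=
        Asymptotics.isBigO_of_div_tendsto_nhds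
          (hLne.mono fun T hT h0 => absurd h0 (pow_ne_zero _ hT)) _ hQs
      refine Asymptotics.IsLittleO.tendsto_div_nhds_zero (Asymptotics.IsLittleO.trans_isBigO ?_ hO)
      simpa [Function.comp_def] using ho
    have hGT' : Tendsto (fun T => (cj (G T (T ^ l)) - G 0 (T ^ l)) / T ^ (l * m + l)) L (𝓝 0) := by
      have := tendsto_cj_div hGT
      rw [cj0] at this
      refine this.congr fun T => ?_
      simp [cj]
    have hG00 : Tendsto (fun T => (G 0 (T ^ l) - cj (G 0 (T ^ l))) / T ^ (l * m + l)) L (𝓝 0) :=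
      hGlead.self_of_nhds (fun _ => 0) tendsto_const_nhds
    have lhs := (((hoK.add hQs).add hGzT).sub hGT').sub hG00
    simp only [zero_add, add_zero, sub_zero] at lhs
    refine tendsto_nhds_unique rhs (lhs.congr' ?_)
    filter_upwards [t3.eventually h5, eventually_cj_eq_self] with T e1 e3
    have e4 : cj (T ^ l) = T ^ l := by
      have : cj (T ^ l) = cj T ^ l := by simp [cj]
      rw [this, e3]
    simp only [e3, e4] at e1
    simp only [hRdef, ← e1]
    ring
  exact (eventually_eq_self_of_invariant hqa hq0 (f := fun z => F z 0) hqne hF0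
    hfder hqf).and hGz0
end
end

section
/- Let γ ≥ 0 be an integer and n, m ≥ 1. Let p : ℝ × ℝⁿ × ℝ^m → ℝⁿ and q : ℝ × ℝⁿ × ℝ^m → ℝ be real-analytic in a neighborhood of 0 with q(0,0,θ) not identically zero as a function of θ near 0 ∈ ℝ^m. Suppose ŷ(x,θ) is a real-analytic ℝⁿ-valued function near 0 ∈ ℝ × ℝ^m with ŷ(0,θ) ≡ 0 satisfying the singular differential equation q(x, ŷ(x,θ), θ) · x^{γ+1} · ∂_x ŷ(x,θ) = p(x, ŷ(x,θ), θ) for all (x,θ) near 0 (equivalently x^{γ+1}∂_x ŷ = p/q wherever q ≠ 0). Then there exists an integer k ≥ 0 such that any real-analytic solution y(x,θ) of the same equation near 0 satisfying ∂_x^l y(0,θ) = ∂_x^l ŷ(0,θ) for all 0 ≤ l ≤ k and all θ near 0 satisfies y(x,θ) = ŷ(x,θ) for all (x,θ) near 0. -/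
open Filter Topology

noncomputable section

section FormalSystems

open PowerSeries

variable {R : Type*} [CommRing R]

/-- The singular derivation `Q X^{γ+1} d/dX` on power series. -/
def singularDerivation (Q : R⟦X⟧) (γ : ℕ) : Derivation R R⟦X⟧ R⟦X⟧ :=
  (Q * X ^ (γ + 1)) • derivative R

lemma singularDerivation_apply (Q : R⟦X⟧) (γ : ℕ) (f : R⟦X⟧) :
    singularDerivation Q γ f = Q * X ^ (γ + 1) * derivative R f := rfl

lemma singularDerivation_X_pow_mul (Q : R⟦X⟧) (γ M : ℕ) (v : R⟦X⟧) :
    singularDerivation Q γ (X ^ M * v) =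
      X ^ (M + γ) * (Q * ((M : R⟦X⟧) * v + X * derivative R v)) := by
  rw [singularDerivation_apply, Derivation.leibniz, Derivation.leibniz_pow, derivative_X]
  rcases M with _ | M
  · simp; ring
  · simp only [smul_eq_mul, nsmul_eq_mul, Nat.add_sub_cancel]; ring

lemma X_pow_dvd_singularDerivation (Q : R⟦X⟧) (γ M : ℕ) {f : R⟦X⟧} (hf : X ^ M ∣ f) :
    X ^ M ∣ singularDerivation Q γ f := by
  obtain ⟨v, rfl⟩ := hf
  rw [singularDerivation_X_pow_mul, pow_add, mul_assoc]
  exact dvd_mul_right _ _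

lemma exists_iterate_singularDerivation_X_pow_mul (Q : R⟦X⟧) (γ N : ℕ) (w : R⟦X⟧) (j : ℕ) :
    ∃ v : R⟦X⟧, (singularDerivation Q γ)^[j] (X ^ N * w) = X ^ (N + j * γ) * v ∧
      constantCoeff v = constantCoeff Q ^ j * (∏ l ∈ Finset.range j, ((N : R) + (l * γ : ℕ))) *
        constantCoeff w := by
  induction j with
  | zero => exact ⟨w, by simp, by simp⟩
  | succ j ih =>
    obtain ⟨v, hv, hv0⟩ := ih
    refine ⟨Q * (((N + j * γ : ℕ) : R⟦X⟧) * v + X * derivative R v), ?_, ?_⟩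
    · rw [Function.iterate_succ_apply', hv, singularDerivation_X_pow_mul]
      congr 2
      ring
    · simp only [map_mul, map_add, map_natCast, constantCoeff_X, hv0, Finset.prod_range_succ,
        pow_succ]
      push_cast
      ring

/-- A nonzero finite family of power series is a power of `X` times a family whose constant
coefficients do not all vanish. -/
lemma exists_eq_X_pow_mul_of_ne_zero {ι : Type*} {f : ι → R⟦X⟧} (hf : ∃ i, f i ≠ 0) :
    ∃ (s : ℕ) (d : ι → R⟦X⟧), (∀ i, f i = X ^ s * d i) ∧ ∃ i, constantCoeff (d i) ≠ 0 := by
  classical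
  have hex : ∃ s, ∃ i, coeff s (f i) ≠ 0 := by
    obtain ⟨i, hi⟩ := hf
    obtain ⟨s, hs⟩ := (PowerSeries.exists_coeff_ne_zero_iff_ne_zero).2 hi
    exact ⟨s, i, hs⟩
  have hdvd : ∀ i, X ^ Nat.find hex ∣ f i := fun i => X_pow_dvd_iff.2 fun t ht => by
    by_contra h
    exact Nat.find_min hex ht ⟨i, h⟩
  choose d hd using hdvd
  refine ⟨Nat.find hex, d, hd, ?_⟩
  obtain ⟨i, hi⟩ := Nat.find_spec hex
  refine ⟨i, fun h => hi ?_⟩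
  rw [hd i]
  have := coeff_X_pow_mul (d i) (Nat.find hex) 0
  rw [zero_add] at this
  rw [this, coeff_zero_eq_constantCoeff_apply, h]

open Polynomial in
/-- A nontrivial indicial polynomial has no large natural number as a root. -/
lemma exists_forall_lt_indicial_ne_zero [IsDomain R] [CharZero R] (γ k : ℕ) {q : R} (hq : q ≠ 0)
    {e : Fin k → R} (he : ∃ j, e j ≠ 0) :
    ∃ K : ℕ, ∀ N > K, ∑ j, e j *
      (q ^ (j : ℕ) * ∏ l ∈ Finset.range j, ((N : R) + (l * γ : ℕ))) ≠ 0 := by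
  classical
  let P : Fin k → R[X] := fun j => Polynomial.C (e j * q ^ (j : ℕ)) *
    ∏ l ∈ Finset.range j, (Polynomial.X + Polynomial.C ((l * γ : ℕ) : R))
  have hdeg : ∀ j, e j ≠ 0 → (P j).degree = ((j : ℕ) : WithBot ℕ) := by
    intro j hj
    have h1 : (∏ l ∈ Finset.range j, (Polynomial.X + Polynomial.C ((l * γ : ℕ) : R))).degree
        = ((j : ℕ) : WithBot ℕ) := by
      rw [Polynomial.degree_prod]
      simp only [Polynomial.degree_X_add_C]
      simp
    rw [Polynomial.degree_C_mul (mul_ne_zero hj (pow_ne_zero _ hq)), h1]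
  have hP : ∑ j, P j ≠ 0 := by
    intro h0
    have h := Polynomial.degree_sum_eq_of_disjoint P Finset.univ (by
      rintro i ⟨-, hi⟩ j ⟨-, hj⟩ hij
      have hi' : e i ≠ 0 := fun h => hi (by simp [P, h])
      have hj' : e j ≠ 0 := fun h => hj (by simp [P, h])
      simp only [Function.onFun, Function.comp, hdeg i hi', hdeg j hj', ne_eq, Nat.cast_inj]
      exact fun h => hij (Fin.ext h))
    rw [h0, Polynomial.degree_zero] at h
    obtain ⟨j, hj⟩ := he
    have := Finset.le_sup (f := fun i => (P i).degree) (Finset.mem_univ j)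
    rw [← h, hdeg j hj] at this
    simp at this
  have hfin : {N : ℕ | (∑ j, P j).IsRoot (N : R)}.Finite :=
    (Polynomial.finite_setOfPred_isRoot hP).preimage Nat.cast_injective.injOn
  obtain ⟨K, hK⟩ := hfin.bddAbove
  refine ⟨K, fun N hN h => ?_⟩
  refine absurd (hK (a := N) ?_) (not_le.2 hN)
  change Polynomial.eval _ _ = 0
  rw [Polynomial.eval_finsetSum, ← h]
  refine Finset.sum_congr rfl fun j _ => ?_
  simp [P, Polynomial.eval_prod, mul_assoc]

/-- A nonzero linear differential operator in the singular derivation determines the leading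
coefficient of every series of large order. -/
lemma exists_forall_X_pow_succ_dvd_of_operator [IsDomain R] [CharZero R] {Q : R⟦X⟧} (γ k : ℕ)
    (hQ : constantCoeff Q ≠ 0) {c : Fin k → R⟦X⟧} (hc : ∃ j, c j ≠ 0) :
    ∃ K : ℕ, ∀ N > K, ∀ f : R⟦X⟧, X ^ N ∣ f →
      X ^ (2 * N) ∣ ∑ j, c j * (singularDerivation Q γ)^[j] f → X ^ (N + 1) ∣ f := by
  obtain ⟨s, d, hd, hd0⟩ := exists_eq_X_pow_mul_of_ne_zero
    (f := fun j : Fin k => c j * X ^ ((j : ℕ) * γ)) (by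
      obtain ⟨j, hj⟩ := hc
      exact ⟨j, mul_ne_zero hj (pow_ne_zero _ X_ne_zero)⟩)
  obtain ⟨K, hK⟩ := exists_forall_lt_indicial_ne_zero γ k hQ
    (e := fun j => constantCoeff (d j)) hd0
  refine ⟨max K s, fun N hN f ⟨w, hw⟩ hdvd => ?_⟩
  have hNK : K < N := lt_of_le_of_lt (le_max_left _ _) hN
  have hNs : s < N := lt_of_le_of_lt (le_max_right _ _) hN
  choose v hv hv0 using exists_iterate_singularDerivation_X_pow_mul Q γ N w
  have hsum : ∑ j : Fin k, c j * (singularDerivation Q γ)^[j] f =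
      X ^ (N + s) * ∑ j : Fin k, d j * v j := by
    rw [Finset.mul_sum]
    refine Finset.sum_congr rfl fun j _ => ?_
    rw [hw, hv, pow_add, pow_add]
    linear_combination (X ^ N * v j) * hd j
  have hX : (X : R⟦X⟧) ∣ ∑ j : Fin k, d j * v j := by
    rw [hsum] at hdvd
    have h1 : (X : R⟦X⟧) ^ (N + s) * X ∣ X ^ (N + s) * ∑ j : Fin k, d j * v j := by
      rw [← pow_succ]
      exact (pow_dvd_pow _ (by omega)).trans hdvd
    exact (mul_dvd_mul_iff_left (pow_ne_zero _ X_ne_zero)).1 h1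
  rw [X_dvd_iff, map_sum] at hX
  have hw0 : constantCoeff w = 0 := by
    refine (mul_eq_zero.1 ?_).resolve_left (hK N hNK)
    rw [← hX, Finset.sum_mul]
    refine Finset.sum_congr rfl fun j _ => ?_
    rw [map_mul, hv0]
    ring
  obtain ⟨u, hu⟩ := X_dvd_iff.2 hw0
  exact ⟨u, by rw [hw, hu]; ring⟩

variable {n : ℕ}

/-- The dual connection on row vectors attached to the system `δ z = B z`. -/
def dualConnection (Q : R⟦X⟧) (γ : ℕ) (B : Fin n → Fin n → R⟦X⟧) (u : Fin n → R⟦X⟧) :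
    Fin n → R⟦X⟧ :=
  fun j => singularDerivation Q γ (u j) + ∑ i, u i * B i j

lemma X_pow_dvd_iterate_sub_dualConnection {Q : R⟦X⟧} {γ M : ℕ} {B : Fin n → Fin n → R⟦X⟧}
    {z : Fin n → R⟦X⟧}
    (hz : ∀ i, X ^ M ∣ singularDerivation Q γ (z i) - ∑ j, B i j * z j)
    (u : Fin n → R⟦X⟧) (k : ℕ) :
    X ^ M ∣ (singularDerivation Q γ)^[k] (∑ i, u i * z i) -
      ∑ i, (dualConnection Q γ B)^[k] u i * z i := by
  induction k with
  | zero => simp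
  | succ k ih =>
    rw [Function.iterate_succ_apply', Function.iterate_succ_apply']
    set U := (dualConnection Q γ B)^[k] u
    have h1 := X_pow_dvd_singularDerivation Q γ M ih
    rw [map_sub] at h1
    have h2 : X ^ M ∣ ∑ i, U i * (singularDerivation Q γ (z i) - ∑ j, B i j * z j) :=
      Finset.dvd_sum fun i _ => (hz i).mul_left _
    have h3 : singularDerivation Q γ (∑ i, U i * z i) - ∑ i, dualConnection Q γ B U i * z i =
        ∑ i, U i * (singularDerivation Q γ (z i) - ∑ j, B i j * z j) := by
      have h4 : ∑ j, (∑ i, U i * B i j) * z j = ∑ i, U i * ∑ j, B i j * z j := by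
        simp only [Finset.sum_mul, Finset.mul_sum]
        rw [Finset.sum_comm]
        exact Finset.sum_congr rfl fun i _ => Finset.sum_congr rfl fun j _ => by ring
      simp only [dualConnection, map_sum, Derivation.leibniz, smul_eq_mul, mul_sub, add_mul,
        Finset.sum_add_distrib, Finset.sum_sub_distrib, h4]
      simp only [mul_comm (z _)]
      ring
    have := dvd_add h1 (h3 ▸ h2)
    simpa using this

/-- For a formal singular linear system, an approximate solution of large order `N` and error of
order `2 N` has order at least `N + 1`. -/
theorem exists_forall_X_pow_succ_dvd_of_system [IsDomain R] [CharZero R] {Q : R⟦X⟧} (γ : ℕ)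
    (hQ : constantCoeff Q ≠ 0) (B : Fin n → Fin n → R⟦X⟧) :
    ∃ K : ℕ, ∀ N > K, ∀ z : Fin n → R⟦X⟧, (∀ i, X ^ N ∣ z i) →
      (∀ i, X ^ (2 * N) ∣ singularDerivation Q γ (z i) - ∑ j, B i j * z j) →
      ∀ i, X ^ (N + 1) ∣ z i := by
  have hrel : ∀ i : Fin n, ∃ c : Fin (n + 1) → R⟦X⟧,
      ∑ j, c j • (dualConnection Q γ B)^[(j : ℕ)] (Pi.single i 1) = 0 ∧ ∃ j, c j ≠ 0 := by
    intro i
    rw [← Fintype.not_linearIndependent_iff]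
    intro h
    simpa using h.fintype_card_le_finrank
  choose c hc hc0 using hrel
  choose K hK using fun i => exists_forall_X_pow_succ_dvd_of_operator γ (n + 1) hQ (hc0 i)
  refine ⟨Finset.univ.sup K, fun N hN z hz hsys i => ?_⟩
  refine hK i N (lt_of_le_of_lt (Finset.le_sup (Finset.mem_univ i)) hN) (z i) (hz i) ?_
  have h1 : ∀ j : Fin (n + 1), X ^ (2 * N) ∣ c i j * ((singularDerivation Q γ)^[j] (z i) -
      ∑ l, (dualConnection Q γ B)^[j] (Pi.single i 1) l * z l) := fun j => by
    have := X_pow_dvd_iterate_sub_dualConnection hsys (Pi.single i 1) j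
    rw [Finset.sum_eq_single i (by intro b _ hb; simp [Pi.single_eq_of_ne hb]) (by simp)] at this
    rw [Pi.single_eq_same, one_mul] at this
    exact this.mul_left _
  have h2 : ∑ j : Fin (n + 1), c i j *
      ∑ l, (dualConnection Q γ B)^[j] (Pi.single i 1) l * z l = 0 := by
    simp only [Finset.mul_sum]
    rw [Finset.sum_comm]
    refine Finset.sum_eq_zero fun l _ => ?_
    have := congrFun (hc i) l
    simp only [Finset.sum_apply, Pi.smul_apply, smul_eq_mul, Pi.zero_apply] at this
    simp only [← mul_assoc, ← Finset.sum_mul, this, zero_mul]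
  have h3 := Finset.dvd_sum (s := Finset.univ) fun j _ => h1 j
  simpa only [mul_sub, Finset.sum_sub_distrib, h2, sub_zero] using h3

end FormalSystems

section FirstVariable

variable {E : Type*}

/-- The partial derivative with respect to the first, real, variable. -/
def xDeriv (f : ℝ × E → ℝ) : ℝ × E → ℝ := fun z => deriv (fun t => f (t, z.2)) z.1

lemma iterate_xDeriv_apply (f : ℝ × E → ℝ) (N : ℕ) (z : ℝ × E) :
    xDeriv^[N] f z = iteratedDeriv N (fun t => f (t, z.2)) z.1 := by
  induction N generalizing z with
  | zero => simp
  | succ N ih =>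
    rw [Function.iterate_succ_apply', iteratedDeriv_succ, xDeriv]
    congr 1
    ext t
    rw [ih]

lemma xDeriv_const (c : ℝ) : xDeriv (fun _ : ℝ × E => c) = fun _ => 0 := by
  ext z
  simp [xDeriv]

lemma iterate_xDeriv_zero (N : ℕ) : xDeriv^[N] (fun _ : ℝ × E => (0 : ℝ)) = fun _ => 0 := by
  induction N with
  | zero => rfl
  | succ N ih => rw [Function.iterate_succ_apply', ih, xDeriv_const]

lemma iterate_xDeriv_neg (f : ℝ × E → ℝ) (N : ℕ) : xDeriv^[N] (-f) = -xDeriv^[N] f := by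
  ext z
  rw [Pi.neg_apply, iterate_xDeriv_apply, iterate_xDeriv_apply, ← iteratedDeriv_neg]
  rfl

end FirstVariable

section FirstVariableGerm

variable {E : Type*} [NormedAddCommGroup E]

lemma xDeriv_eventuallyEq {f g : ℝ × E → ℝ} {z : ℝ × E} (h : f =ᶠ[𝓝 z] g) :
    xDeriv f =ᶠ[𝓝 z] xDeriv g := by
  filter_upwards [eventually_eventually_nhds.2 h] with w hw
  refine Filter.EventuallyEq.deriv_eq ?_
  have hc : Tendsto (fun t : ℝ => (t, w.2)) (𝓝 w.1) (𝓝 w) :=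
    Continuous.tendsto' (by fun_prop) _ _ rfl
  exact hc.eventually hw

lemma iterate_xDeriv_eventuallyEq {f g : ℝ × E → ℝ} {z : ℝ × E} (h : f =ᶠ[𝓝 z] g) (N : ℕ) :
    xDeriv^[N] f =ᶠ[𝓝 z] xDeriv^[N] g := by
  induction N with
  | zero => exact h
  | succ N ih =>
    simp only [Function.iterate_succ_apply']
    exact xDeriv_eventuallyEq ih

/-- The germ at the origin of the restriction of a function to the slice `x = 0`. -/
def sliceGerm (f : ℝ × E → ℝ) : Germ (𝓝 (0 : E)) ℝ := ((fun θ => f (0, θ) : E → ℝ) : Germ _ ℝ)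

lemma tendsto_slice : Tendsto (fun θ : E => ((0 : ℝ), θ)) (𝓝 0) (𝓝 0) :=
  Continuous.tendsto' (by fun_prop) _ _ rfl

lemma sliceGerm_congr {f g : ℝ × E → ℝ} (h : f =ᶠ[𝓝 0] g) : sliceGerm f = sliceGerm g :=
  Germ.coe_eq.2 (tendsto_slice.eventually h)

end FirstVariableGerm

section AnalyticGerms

variable {E : Type*} [NormedAddCommGroup E] [NormedSpace ℝ E]

variable (E) in
/-- The ring of germs at the origin of real-analytic functions. -/
def analyticGermRing : Subring (Germ (𝓝 (0 : E)) ℝ) where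
  carrier := {g | ∃ f : E → ℝ, AnalyticAt ℝ f 0 ∧ (f : Germ (𝓝 (0 : E)) ℝ) = g}
  mul_mem' := by
    rintro _ _ ⟨f, hf, rfl⟩ ⟨g, hg, rfl⟩
    exact ⟨f * g, hf.mul hg, rfl⟩
  one_mem' := ⟨1, analyticAt_const, rfl⟩
  add_mem' := by
    rintro _ _ ⟨f, hf, rfl⟩ ⟨g, hg, rfl⟩
    exact ⟨f + g, hf.add hg, rfl⟩
  zero_mem' := ⟨0, analyticAt_const, rfl⟩
  neg_mem' := by
    rintro _ ⟨f, hf, rfl⟩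
    exact ⟨-f, hf.neg, rfl⟩

lemma eventuallyEq_zero_or_of_mul_eventuallyEq_zero {f g : E → ℝ} (hf : AnalyticAt ℝ f 0)
    (hg : AnalyticAt ℝ g 0) (h : f * g =ᶠ[𝓝 0] 0) : f =ᶠ[𝓝 0] 0 ∨ g =ᶠ[𝓝 0] 0 := by
  obtain ⟨ε, hε, hball⟩ := Metric.eventually_nhds_iff_ball.1
    ((hf.eventually_analyticAt.and hg.eventually_analyticAt).and h)
  by_contra! hne
  obtain ⟨a, ha, hfa⟩ : ∃ a ∈ Metric.ball (0 : E) ε, f a ≠ 0 := by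
    by_contra! h0
    exact hne.1 (Filter.eventually_of_mem (Metric.ball_mem_nhds _ hε) h0)
  have hga : g =ᶠ[𝓝 a] 0 := by
    filter_upwards [(hball a ha).1.1.continuousAt.eventually_ne hfa,
      Metric.isOpen_ball.mem_nhds ha] with b hb hb'
    exact (mul_eq_zero.1 (hball b hb').2).resolve_left hb
  have hg0 := AnalyticOnNhd.eqOn_zero_of_preconnected_of_eventuallyEq_zero
    (fun b hb => (hball b hb).1.2) (convex_ball (0 : E) ε).isPreconnected ha hga
  exact hne.2 (Filter.eventually_of_mem (Metric.ball_mem_nhds _ hε) hg0)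

instance : IsDomain (analyticGermRing E) := by
  have : NoZeroDivisors (analyticGermRing E) := by
    refine ⟨?_⟩
    rintro ⟨_, f, hf, rfl⟩ ⟨_, g, hg, rfl⟩ h
    have h' : f * g =ᶠ[𝓝 0] 0 := Germ.coe_eq.1 (congrArg Subtype.val h)
    rcases eventuallyEq_zero_or_of_mul_eventuallyEq_zero hf hg h' with h0 | h0
    · exact Or.inl (Subtype.ext (Germ.coe_eq.2 h0))
    · exact Or.inr (Subtype.ext (Germ.coe_eq.2 h0))
  exact NoZeroDivisors.to_isDomain _

instance : CharZero (analyticGermRing E) := by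
  refine charZero_of_inj_zero fun k hk => ?_
  have h : (fun _ : E => (k : ℝ)) =ᶠ[𝓝 0] fun _ => 0 := Germ.coe_eq.1 (congrArg Subtype.val hk)
  exact Nat.cast_eq_zero.1 h.self_of_nhds

lemma AnalyticAt.slice {f : ℝ × E → ℝ} {z : ℝ × E} (hf : AnalyticAt ℝ f z) :
    AnalyticAt ℝ (fun t => f (t, z.2)) z.1 :=
  AnalyticAt.fun_comp (g := f) hf (by fun_prop)

lemma AnalyticAt.deriv_fst {f : ℝ × E → ℝ} {z : ℝ × E} (hf : AnalyticAt ℝ f z) :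
    AnalyticAt ℝ (xDeriv f) z := by
  have h : AnalyticAt ℝ (fun w => fderiv ℝ f w (1, 0)) z := 
    AnalyticAt.fun_comp ((ContinuousLinearMap.apply ℝ ℝ ((1, 0) : ℝ × E)).analyticAt _) hf.fderiv
  refine h.congr ?_
  filter_upwards [hf.eventually_analyticAt] with w hw
  have h1 : HasDerivAt (fun t : ℝ => (t, w.2)) (1, 0) w.1 :=
    (hasDerivAt_id w.1).prodMk (hasDerivAt_const _ _)
  exact (hw.differentiableAt.hasFDerivAt.comp_hasDerivAt w.1 h1).deriv.symm

lemma AnalyticAt.iterate_deriv_fst {f : ℝ × E → ℝ} {z : ℝ × E} (hf : AnalyticAt ℝ f z) (N : ℕ) :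
    AnalyticAt ℝ (xDeriv^[N] f) z := by
  induction N with
  | zero => exact hf
  | succ N ih =>
    rw [Function.iterate_succ_apply']
    exact ih.deriv_fst

lemma xDeriv_add_eventuallyEq {f g : ℝ × E → ℝ} {z : ℝ × E} (hf : AnalyticAt ℝ f z)
    (hg : AnalyticAt ℝ g z) : xDeriv (f + g) =ᶠ[𝓝 z] xDeriv f + xDeriv g := by
  filter_upwards [hf.eventually_analyticAt, hg.eventually_analyticAt] with w hw hw'
  exact deriv_add hw.slice.differentiableAt hw'.slice.differentiableAt

lemma xDeriv_mul_eventuallyEq {f g : ℝ × E → ℝ} {z : ℝ × E} (hf : AnalyticAt ℝ f z)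
    (hg : AnalyticAt ℝ g z) : xDeriv (f * g) =ᶠ[𝓝 z] xDeriv f * g + f * xDeriv g := by
  filter_upwards [hf.eventually_analyticAt, hg.eventually_analyticAt] with w hw hw'
  exact deriv_mul hw.slice.differentiableAt hw'.slice.differentiableAt

lemma iterate_xDeriv_add_eventuallyEq {f g : ℝ × E → ℝ} {z : ℝ × E} (hf : AnalyticAt ℝ f z)
    (hg : AnalyticAt ℝ g z) (N : ℕ) :
    xDeriv^[N] (f + g) =ᶠ[𝓝 z] xDeriv^[N] f + xDeriv^[N] g := by
  induction N with
  | zero => rfl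
  | succ N ih =>
    simp only [Function.iterate_succ_apply']
    exact (xDeriv_eventuallyEq ih).trans
      (xDeriv_add_eventuallyEq (hf.iterate_deriv_fst N) (hg.iterate_deriv_fst N))

open PowerSeries

/-- `HasExpansion f F` says that `f` is analytic at the origin and `F` is its Taylor series in the
first variable, with coefficients viewed as germs in the remaining variables. -/
structure HasExpansion (f : ℝ × E → ℝ) (F : (analyticGermRing E)⟦X⟧) : Prop where
  analyticAt : AnalyticAt ℝ f 0
  constantCoeff_eq (N : ℕ) : ((constantCoeff ((derivative (analyticGermRing E))^[N] F) :
    analyticGermRing E) : Germ (𝓝 (0 : E)) ℝ) = sliceGerm (xDeriv^[N] f)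

lemma exists_hasExpansion {f : ℝ × E → ℝ} (hf : AnalyticAt ℝ f 0) : ∃ F, HasExpansion f F := by
  have hmem : ∀ N : ℕ, 
      ((fun θ => xDeriv^[N] f (0, θ) / N.factorial : E → ℝ) : Germ (𝓝 (0 : E)) ℝ) ∈
      analyticGermRing E := fun N => by
    refine ⟨_, ?_, rfl⟩
    refine AnalyticAt.div_const ?_
    exact AnalyticAt.fun_comp (g := xDeriv^[N] f) (hf.iterate_deriv_fst N) (by fun_prop)
  refine ⟨PowerSeries.mk fun N => ⟨_, hmem N⟩, hf, fun N => ?_⟩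
  rw [constantCoeff_iterate_derivative, coeff_mk, sliceGerm]
  simp only [Subring.coe_mul, Subring.coe_natCast]
  refine Germ.coe_eq.2 (Filter.Eventually.of_forall fun θ => ?_)
  change (N.factorial : ℝ) * _ = _
  field_simp

lemma HasExpansion.congr {f g : ℝ × E → ℝ} {F : (analyticGermRing E)⟦X⟧} (hf : HasExpansion f F)
    (h : f =ᶠ[𝓝 0] g) : HasExpansion g F :=
  ⟨hf.analyticAt.congr h, fun N => by
    rw [hf.constantCoeff_eq, sliceGerm_congr (iterate_xDeriv_eventuallyEq h N)]⟩

lemma HasExpansion.deriv_fst {f : ℝ × E → ℝ} {F : (analyticGermRing E)⟦X⟧} (hf : HasExpansion f F) :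
    HasExpansion (xDeriv f) (derivative _ F) :=
  ⟨hf.analyticAt.deriv_fst, fun N => by
    simpa only [Function.iterate_succ_apply] using hf.constantCoeff_eq (N + 1)⟩

lemma HasExpansion.add {f g : ℝ × E → ℝ} {F G : (analyticGermRing E)⟦X⟧} (hf : HasExpansion f F)
    (hg : HasExpansion g G) : HasExpansion (f + g) (F + G) :=
  ⟨hf.analyticAt.add hg.analyticAt, fun N => by
    rw [sliceGerm_congr (iterate_xDeriv_add_eventuallyEq hf.analyticAt hg.analyticAt N),
      iterate_map_add, map_add, Subring.coe_add, hf.constantCoeff_eq, hg.constantCoeff_eq]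
    rfl⟩

lemma HasExpansion.neg {f : ℝ × E → ℝ} {F : (analyticGermRing E)⟦X⟧} (hf : HasExpansion f F) :
    HasExpansion (-f) (-F) :=
  ⟨hf.analyticAt.neg, fun N => by
    rw [iterate_xDeriv_neg, iterate_map_neg, map_neg, Subring.coe_neg, hf.constantCoeff_eq]
    rfl⟩

lemma HasExpansion.sub {f g : ℝ × E → ℝ} {F G : (analyticGermRing E)⟦X⟧} (hf : HasExpansion f F)
    (hg : HasExpansion g G) : HasExpansion (f - g) (F - G) := by
  simpa only [sub_eq_add_neg] using hf.add hg.neg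

lemma hasExpansion_zero : HasExpansion (0 : ℝ × E → ℝ) 0 :=
  ⟨analyticAt_const, fun N => by
    rw [iterate_map_zero, map_zero]
    exact (congrArg sliceGerm (iterate_xDeriv_zero (E := E) N)).symm⟩

lemma hasExpansion_one : HasExpansion (1 : ℝ × E → ℝ) 1 :=
  ⟨analyticAt_const, fun N => by
    rcases N with _ | N
    · simp only [Function.iterate_zero, id, map_one]
      rfl
    · have h : xDeriv (1 : ℝ × E → ℝ) = fun _ => 0 := xDeriv_const 1
      rw [Function.iterate_succ_apply, Function.iterate_succ_apply, derivative_one,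
        iterate_map_zero, map_zero, h, iterate_xDeriv_zero]
      rfl⟩

lemma hasExpansion_fst : HasExpansion (fun z : ℝ × E => z.1) X :=
  ⟨analyticAt_fst, fun N => by
    rcases N with _ | N
    · simp only [Function.iterate_zero, id, constantCoeff_X]
      rfl
    · have h : xDeriv (fun z : ℝ × E => z.1) = 1 := by
        ext z
        simp [xDeriv]
      rw [Function.iterate_succ_apply, Function.iterate_succ_apply, derivative_X, h]
      exact hasExpansion_one.constantCoeff_eq N⟩

lemma HasExpansion.sum {ι : Type*} (s : Finset ι) {f : ι → ℝ × E → ℝ}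
    {F : ι → (analyticGermRing E)⟦X⟧} (h : ∀ i, HasExpansion (f i) (F i)) :
    HasExpansion (∑ i ∈ s, f i) (∑ i ∈ s, F i) := by
  classical
  induction s using Finset.induction_on with
  | empty => simpa using hasExpansion_zero
  | insert i s hi ih =>
    rw [Finset.sum_insert hi, Finset.sum_insert hi]
    exact (h i).add ih

lemma HasExpansion.mul {f g : ℝ × E → ℝ} {F G : (analyticGermRing E)⟦X⟧} (hf : HasExpansion f F)
    (hg : HasExpansion g G) : HasExpansion (f * g) (F * G) := by
  refine ⟨hf.analyticAt.mul hg.analyticAt, fun N => ?_⟩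
  induction N generalizing f g F G with
  | zero =>
    have h1 := hf.constantCoeff_eq 0
    have h2 := hg.constantCoeff_eq 0
    simp only [Function.iterate_zero, id] at h1 h2 ⊢
    rw [map_mul, Subring.coe_mul, h1, h2]
    rfl
  | succ N ih =>
    have h1 : (xDeriv^[N] (xDeriv f * g + f * xDeriv g)) =ᶠ[𝓝 0] _ :=
      iterate_xDeriv_add_eventuallyEq
        (hf.deriv_fst.analyticAt.mul hg.analyticAt) (hf.analyticAt.mul hg.deriv_fst.analyticAt) N
    rw [Function.iterate_succ_apply, Function.iterate_succ_apply, sliceGerm_congr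
      ((iterate_xDeriv_eventuallyEq
        (xDeriv_mul_eventuallyEq hf.analyticAt hg.analyticAt) N).trans h1),
      Derivation.leibniz, smul_eq_mul, smul_eq_mul, iterate_map_add, map_add, Subring.coe_add,
      ih hf hg.deriv_fst, mul_comm G, ih hf.deriv_fst hg, add_comm]
    rfl

lemma HasExpansion.pow {f : ℝ × E → ℝ} {F : (analyticGermRing E)⟦X⟧} (hf : HasExpansion f F)
    (k : ℕ) : HasExpansion (f ^ k) (F ^ k) := by
  induction k with
  | zero => simpa using hasExpansion_one
  | succ k ih => simpa only [pow_succ] using ih.mul hf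

lemma eventually_analyticAt_slice {f : ℝ × E → ℝ} (hf : AnalyticAt ℝ f 0) :
    ∀ᶠ θ : E in 𝓝 0, AnalyticAt ℝ (fun t => f (t, θ)) 0 := by
  filter_upwards [tendsto_slice.eventually hf.eventually_analyticAt] with θ hθ
  exact hθ.slice

lemma HasExpansion.coeff_eq_zero_iff {f : ℝ × E → ℝ} {F : (analyticGermRing E)⟦X⟧}
    (hf : HasExpansion f F) (N : ℕ) :
    coeff N F = 0 ↔ ∀ᶠ θ : E in 𝓝 0, iteratedDeriv N (fun t => f (t, θ)) 0 = 0 := by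
  have h1 : coeff N F = 0 ↔
      constantCoeff ((derivative (analyticGermRing E))^[N] F) = 0 := by
    rw [constantCoeff_iterate_derivative, mul_eq_zero,
      or_iff_right (Nat.cast_ne_zero.2 N.factorial_ne_zero)]
  rw [h1, ← Subring.coe_eq_zero_iff, hf.constantCoeff_eq]
  refine (Germ.coe_eq (g := fun _ => (0 : ℝ))).trans ?_
  simp only [Filter.EventuallyEq, iterate_xDeriv_apply]

lemma HasExpansion.X_pow_dvd_iff {f : ℝ × E → ℝ} {F : (analyticGermRing E)⟦X⟧}
    (hf : HasExpansion f F) (N : ℕ) :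
    X ^ N ∣ F ↔ ∀ᶠ θ : E in 𝓝 0, (N : ℕ∞) ≤ analyticOrderAt (fun t => f (t, θ)) 0 := by
  have h1 : (∀ᶠ θ : E in 𝓝 0, (N : ℕ∞) ≤ analyticOrderAt (fun t => f (t, θ)) 0) ↔
      ∀ᶠ θ : E in 𝓝 0, ∀ l ∈ Set.Iio N, iteratedDeriv l (fun t => f (t, θ)) 0 = 0 := by
    refine Filter.eventually_congr ?_
    filter_upwards [eventually_analyticAt_slice hf.analyticAt] with θ hθ
    exact natCast_le_analyticOrderAt_iff_iteratedDeriv_eq_zero hθ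
  rw [h1, Filter.eventually_all_finite (Set.finite_Iio N), PowerSeries.X_pow_dvd_iff]
  exact forall₂_congr fun l _ => hf.coeff_eq_zero_iff l

lemma HasExpansion.eventually_eq_zero {f : ℝ × E → ℝ} (hf : HasExpansion f 0) :
    ∀ᶠ z : ℝ × E in 𝓝 0, f z = 0 := by
  obtain ⟨ε, hε, hball⟩ := Metric.eventually_nhds_iff_ball.1 hf.analyticAt.eventually_analyticAt
  have hmem : ∀ {t : ℝ} {θ : E}, t ∈ Metric.ball 0 ε → θ ∈ Metric.ball 0 ε →
      AnalyticAt ℝ f (t, θ) := fun {t θ} ht hθ => hball _ (by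
    rw [show (0 : ℝ × E) = (0, 0) from rfl, ← ball_prod_same]
    exact ⟨ht, hθ⟩)
  have h0 : (0 : ℝ) ∈ Metric.ball 0 ε := Metric.mem_ball_self hε
  have hcoeff : ∀ N : ℕ, ∀ θ ∈ Metric.ball (0 : E) ε,
      iteratedDeriv N (fun t => f (t, θ)) 0 = 0 := by
    intro N
    refine AnalyticOnNhd.eqOn_zero_of_preconnected_of_eventuallyEq_zero (𝕜 := ℝ)
      (f := fun θ : E => iteratedDeriv N (fun t => f (t, θ)) 0) (fun θ hθ => ?_)
      (convex_ball (0 : E) ε).isPreconnected (Metric.mem_ball_self hε)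
      ((hf.coeff_eq_zero_iff N).1 (by simp))
    have h2 : AnalyticAt ℝ (fun θ : E => xDeriv^[N] f (0, θ)) θ :=
      AnalyticAt.fun_comp (g := xDeriv^[N] f) ((hmem h0 hθ).iterate_deriv_fst N) (by fun_prop)
    simpa only [iterate_xDeriv_apply] using h2
  filter_upwards [Metric.ball_mem_nhds (0 : ℝ × E) hε] with z hz
  rw [show (0 : ℝ × E) = (0, 0) from rfl, ← ball_prod_same] at hz
  obtain ⟨hz1, hz2⟩ := hz
  have hord : analyticOrderAt (fun t => f (t, z.2)) 0 = ⊤ := by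
    refine ENat.eq_top_iff_forall_ge.2 fun N => ?_
    exact (natCast_le_analyticOrderAt_iff_iteratedDeriv_eq_zero (hmem h0 hz2).slice).2
      fun l _ => hcoeff l _ hz2
  exact AnalyticOnNhd.eqOn_zero_of_preconnected_of_eventuallyEq_zero (𝕜 := ℝ)
    (f := fun t => f (t, z.2)) (fun t ht => (hmem ht hz2).slice)
    (convex_ball (0 : ℝ) ε).isPreconnected h0 (analyticOrderAt_eq_top.1 hord) hz1

end AnalyticGerms

section OrderOfVanishing

open Asymptotics

lemma AnalyticAt.natCast_le_analyticOrderAt_iff_isBigO {f : ℝ → ℝ} (hf : AnalyticAt ℝ f 0)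
    (M : ℕ) : (M : ℕ∞) ≤ analyticOrderAt f 0 ↔ f =O[𝓝 0] fun x => x ^ M := by
  constructor
  · rw [natCast_le_analyticOrderAt hf]
    rintro ⟨g, hg, hfg⟩
    have h1 : (fun x : ℝ => x ^ M * g x) =O[𝓝 0] fun x => x ^ M * (1 : ℝ) :=
      (isBigO_refl _ _).mul (hg.continuousAt.isBigO_one ℝ)
    refine (h1.congr' ?_ (by simp))
    filter_upwards [hfg] with x hx
    simp [hx]
  · induction M with
    | zero => simp
    | succ M ih =>
      intro h
      have hM : f =O[𝓝 0] fun x => x ^ M := by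
        refine h.trans ?_
        have h2 : (fun x : ℝ => x ^ M * x) =O[𝓝 0] fun x => x ^ M * (1 : ℝ) :=
          (isBigO_refl _ _).mul (continuousAt_id.isBigO_one ℝ)
        simpa [pow_succ] using h2
      obtain ⟨g, hg, hfg⟩ := (natCast_le_analyticOrderAt hf).1 (ih hM)
      have hg0 : g 0 = 0 := by
        obtain ⟨C, hC⟩ := h.bound
        have h1 : ∀ᶠ x in 𝓝[≠] (0 : ℝ), ‖g x‖ ≤ C * |x| := by
          filter_upwards [hfg.filter_mono nhdsWithin_le_nhds, hC.filter_mono nhdsWithin_le_nhds,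
            self_mem_nhdsWithin] with x hx hx' hx0
          have hpos : 0 < |x| ^ M := pow_pos (abs_pos.2 hx0) M
          rw [hx, sub_zero, norm_smul, norm_pow, norm_pow, Real.norm_eq_abs x] at hx'
          rw [pow_succ] at hx'
          refine le_of_mul_le_mul_left ?_ hpos
          linarith
        have h2 : Tendsto (fun x : ℝ => C * |x|) (𝓝[≠] 0) (𝓝 0) :=
          ((by fun_prop : Continuous fun x : ℝ => C * |x|).tendsto' 0 0 (by simp)).mono_left
            nhdsWithin_le_nhds
        exact tendsto_nhds_unique (hg.continuousAt.tendsto.mono_left nhdsWithin_le_nhds)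
          (squeeze_zero_norm' h1 h2)
      have hg1 : ((1 : ℕ) : ℕ∞) ≤ analyticOrderAt g 0 := by
        rw [natCast_le_analyticOrderAt_iff_iteratedDeriv_eq_zero hg]
        intro i hi
        obtain rfl : i = 0 := by omega
        simpa using hg0
      obtain ⟨u, hu, hgu⟩ := (natCast_le_analyticOrderAt hg).1 hg1
      refine (natCast_le_analyticOrderAt hf).2 ⟨u, hu, ?_⟩
      filter_upwards [hfg, hgu] with x hx hx'
      rw [hx, hx', pow_one, pow_succ, mul_smul]

end OrderOfVanishing

section GraphMap

variable {E : Type*} {n : ℕ}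

/-- The graph of a vector-valued function of `(x, θ)`, as a map into `(x, y, θ)`-space. -/
def graphMap (Y : ℝ × E → Fin n → ℝ) (z : ℝ × E) : ℝ × (Fin n → ℝ) × E := (z.1, Y z, z.2)

lemma graphMap_zero [NormedAddCommGroup E] {Y : ℝ × E → Fin n → ℝ} (hY : Y 0 = 0) : graphMap Y 0 = 0 := by
  simp [graphMap, hY]

end GraphMap

section Linearization

/-- The first-order Taylor remainder of an analytic function is quadratic, uniformly in the base
point. -/
lemma AnalyticAt.exists_norm_sub_fderiv_le {W : Type*} [NormedAddCommGroup W] [NormedSpace ℝ W]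
    {P : W → ℝ} {w : W} (hP : AnalyticAt ℝ P w) :
    ∃ C : ℝ, ∀ᶠ ab : W × W in 𝓝 (w, w),
      |P ab.2 - P ab.1 - fderiv ℝ P ab.1 (ab.2 - ab.1)| ≤ C * ‖ab.2 - ab.1‖ ^ 2 := by
  obtain ⟨K, t, ht, hK⟩ := hP.fderiv.contDiffAt.exists_lipschitzOnWith
  obtain ⟨ε, hε, hball⟩ := Metric.eventually_nhds_iff_ball.1 (hP.eventually_analyticAt.and ht)
  refine ⟨K, ?_⟩
  filter_upwards [prod_mem_nhds (Metric.ball_mem_nhds w hε) (Metric.ball_mem_nhds w hε)]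
  rintro ⟨a, b⟩ ⟨ha, hb⟩
  have hseg : segment ℝ a b ⊆ Metric.ball w ε := (convex_ball w ε).segment_subset ha hb
  have h := Convex.norm_image_sub_le_of_norm_fderiv_le' (f := P) (𝕜 := ℝ) (C := K * ‖b - a‖)
    (φ := fderiv ℝ P a) (fun x hx => (hball x (hseg hx)).1.differentiableAt) (fun x hx => ?_)
    (convex_segment a b) (left_mem_segment ℝ a b) (right_mem_segment ℝ a b)
  · rw [pow_two, ← mul_assoc]
    exact h
  · refine (hK.norm_sub_le (hball x (hseg hx)).2 (hball a ha).2).trans ?_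
    exact mul_le_mul_of_nonneg_left (norm_sub_le_of_mem_segment hx) K.2

lemma AnalyticAt.exists_abs_sub_le {W : Type*} [NormedAddCommGroup W] [NormedSpace ℝ W]
    {P : W → ℝ} {w : W} (hP : AnalyticAt ℝ P w) :
    ∃ C : ℝ, ∀ᶠ ab : W × W in 𝓝 (w, w), |P ab.2 - P ab.1| ≤ C * ‖ab.2 - ab.1‖ := by
  obtain ⟨K, t, ht, hK⟩ := hP.contDiffAt.exists_lipschitzOnWith
  refine ⟨K, ?_⟩
  filter_upwards [prod_mem_nhds ht ht]
  rintro ⟨a, b⟩ ⟨ha, hb⟩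
  exact hK.norm_sub_le hb ha

variable {E : Type*} [NormedAddCommGroup E] [NormedSpace ℝ E] {n : ℕ}

lemma clm_apply_prod_pi_eq_sum (L : ℝ × (Fin n → ℝ) × E →L[ℝ] ℝ) (v : Fin n → ℝ) :
    L (0, v, 0) = ∑ j, L (0, Pi.single j 1, 0) * v j := by
  have h : ((0 : ℝ), v, (0 : E)) =
      ∑ j, v j • ((0 : ℝ), (Pi.single j 1 : Fin n → ℝ), (0 : E)) := by
    refine Prod.ext ?_ (Prod.ext ?_ ?_)
    · simp [Prod.fst_sum]
    · rw [Prod.snd_sum, Prod.fst_sum]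
      simp only [Prod.smul_snd, Prod.smul_fst]
      exact pi_eq_sum_univ' v
    · simp [Prod.snd_sum]
  rw [h, map_sum]
  exact Finset.sum_congr rfl fun j _ => by rw [map_smul, smul_eq_mul, mul_comm]

lemma AnalyticAt.graphMap {Y : ℝ × E → Fin n → ℝ} {z : ℝ × E} (hY : AnalyticAt ℝ Y z) :
    AnalyticAt ℝ (graphMap Y) z :=
  analyticAt_fst.prod (hY.prod analyticAt_snd)

lemma AnalyticAt.comp_graphMap {F : Type*} [NormedAddCommGroup F] [NormedSpace ℝ F]
    {P : ℝ × (Fin n → ℝ) × E → F} {Y : ℝ × E → Fin n → ℝ}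
    (hP : AnalyticAt ℝ P 0) (hY : AnalyticAt ℝ Y 0) (hY0 : Y 0 = 0) :
    AnalyticAt ℝ (fun z => P (_root_.graphMap Y z)) 0 :=
  AnalyticAt.fun_comp (g := P) (by rwa [graphMap_zero hY0]) hY.graphMap

/-- The coefficients of the linearization along `Y` of the equation
`q x^{γ+1} ∂ₓ Y i = P`, for a component `i`. -/
def linearizedCoeff (γ : ℕ) (P q : ℝ × (Fin n → ℝ) × E → ℝ) (Y : ℝ × E → Fin n → ℝ)
    (i j : Fin n) (z : ℝ × E) : ℝ :=
  fderiv ℝ P (graphMap Y z) (0, Pi.single j 1, 0) -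
    z.1 ^ (γ + 1) * xDeriv (fun w => Y w i) z *
      fderiv ℝ q (graphMap Y z) (0, Pi.single j 1, 0)

lemma analyticAt_fderiv_graphMap_apply {P : ℝ × (Fin n → ℝ) × E → ℝ} {Y : ℝ × E → Fin n → ℝ}
    (hP : AnalyticAt ℝ P 0) (hY : AnalyticAt ℝ Y 0) (hY0 : Y 0 = 0)
    (v : ℝ × (Fin n → ℝ) × E) :
    AnalyticAt ℝ (fun z => fderiv ℝ P (graphMap Y z) v) 0 :=
  AnalyticAt.fun_comp ((ContinuousLinearMap.apply ℝ ℝ v).analyticAt _)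
    (hP.fderiv.comp_graphMap hY hY0)

lemma analyticAt_linearizedCoeff (γ : ℕ) {P q : ℝ × (Fin n → ℝ) × E → ℝ}
    {Y : ℝ × E → Fin n → ℝ} (hP : AnalyticAt ℝ P 0) (hq : AnalyticAt ℝ q 0)
    (hY : AnalyticAt ℝ Y 0) (hY0 : Y 0 = 0) (i j : Fin n) :
    AnalyticAt ℝ (linearizedCoeff γ P q Y i j) 0 :=
  (analyticAt_fderiv_graphMap_apply hP hY hY0 _).sub
    (((analyticAt_fst.pow _).mul (analyticAt_pi_iff.1 hY i).deriv_fst).mul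
      (analyticAt_fderiv_graphMap_apply hq hY hY0 _))

/-- The difference of two solutions satisfies the linearized equation up to a quadratic error. -/
lemma exists_linearization_error_bound {γ : ℕ} {P q : ℝ × (Fin n → ℝ) × E → ℝ}
    {Y Y' : ℝ × E → Fin n → ℝ} (hP : AnalyticAt ℝ P 0) (hq : AnalyticAt ℝ q 0)
    (hY : AnalyticAt ℝ Y 0) (hY0 : Y 0 = 0) (hY' : AnalyticAt ℝ Y' 0) (hY0' : Y' 0 = 0)
    {i : Fin n}
    (heq : ∀ᶠ z in 𝓝 0, q (graphMap Y z) * z.1 ^ (γ + 1) * xDeriv (fun w => Y w i) z =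
      P (graphMap Y z))
    (heq' : ∀ᶠ z in 𝓝 0, q (graphMap Y' z) * z.1 ^ (γ + 1) * xDeriv (fun w => Y' w i) z =
      P (graphMap Y' z)) :
    ∃ C : ℝ, ∀ᶠ z in 𝓝 0,
      |q (graphMap Y z) * z.1 ^ (γ + 1) * xDeriv (fun w => Y' w i - Y w i) z -
        ∑ j, linearizedCoeff γ P q Y i j z * (Y' z j - Y z j)| ≤
      C * (‖Y' z - Y z‖ * ‖Y' z - Y z‖ +
        ‖Y' z - Y z‖ * |z.1 * xDeriv (fun w => Y' w i - Y w i) z|) := by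
  obtain ⟨C₁, h₁⟩ := hP.exists_norm_sub_fderiv_le
  obtain ⟨C₂, h₂⟩ := hq.exists_norm_sub_fderiv_le
  obtain ⟨C₃, h₃⟩ := hq.exists_abs_sub_le
  have ht : Tendsto (fun z => (graphMap Y z, graphMap Y' z)) (𝓝 0) (𝓝 (0, 0)) := by
    have h := (hY.graphMap.continuousAt.prodMk hY'.graphMap.continuousAt).tendsto
    rwa [graphMap_zero hY0, graphMap_zero hY0'] at h
  have hYi := analyticAt_pi_iff.1 hY i
  have hYi' := analyticAt_pi_iff.1 hY' i
  have hcoef : AnalyticAt ℝ (fun z : ℝ × E => z.1 ^ (γ + 1) * xDeriv (fun w => Y w i) z) 0 :=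
    (analyticAt_fst.pow _).mul hYi.deriv_fst
  have hD : ∀ᶠ z in 𝓝 0, |z.1 ^ (γ + 1) * xDeriv (fun w => Y w i) z| < 1 :=
    hcoef.continuousAt.abs.eventually_lt_const (by simp)
  have hfst : ∀ᶠ z : ℝ × E in 𝓝 0, |z.1| < 1 :=
    (by fun_prop : Continuous fun z : ℝ × E => |z.1|).continuousAt.eventually_lt_const (by simp)
  refine ⟨|C₁| + |C₂| + |C₃|, ?_⟩
  filter_upwards [ht.eventually h₁, ht.eventually h₂, ht.eventually h₃, heq, heq', hD, hfst,
    hYi.eventually_analyticAt, hYi'.eventually_analyticAt] with z k₁ k₂ k₃ e e' d d' a a'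
  have hdiff : graphMap Y' z - graphMap Y z = (0, Y' z - Y z, 0) := by simp [graphMap]
  have hnorm : ‖graphMap Y' z - graphMap Y z‖ = ‖Y' z - Y z‖ := by
    rw [hdiff]
    simp [Prod.norm_def]
  simp only [hnorm] at k₁ k₂ k₃
  rw [hdiff, clm_apply_prod_pi_eq_sum] at k₁ k₂
  have hx : xDeriv (fun w => Y' w i - Y w i) z =
      xDeriv (fun w => Y' w i) z - xDeriv (fun w => Y w i) z :=
    deriv_sub a'.slice.differentiableAt a.slice.differentiableAt
  have hlin : ∑ j, linearizedCoeff γ P q Y i j z * (Y' z j - Y z j) =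
      ∑ j, fderiv ℝ P (graphMap Y z) (0, Pi.single j 1, 0) * (Y' z - Y z) j -
      z.1 ^ (γ + 1) * xDeriv (fun w => Y w i) z *
        ∑ j, fderiv ℝ q (graphMap Y z) (0, Pi.single j 1, 0) * (Y' z - Y z) j := by
    rw [Finset.mul_sum, ← Finset.sum_sub_distrib]
    refine Finset.sum_congr rfl fun j _ => ?_
    simp only [linearizedCoeff, Pi.sub_apply]
    ring
  rw [hlin]
  set S := ∑ j, fderiv ℝ P (graphMap Y z) (0, Pi.single j 1, 0) * (Y' z - Y z) j
  set T := ∑ j, fderiv ℝ q (graphMap Y z) (0, Pi.single j 1, 0) * (Y' z - Y z) j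
  set D := xDeriv (fun w => Y' w i - Y w i) z
  set r := ‖Y' z - Y z‖
  have hr : 0 ≤ r := norm_nonneg _
  have key : q (graphMap Y z) * z.1 ^ (γ + 1) * D -
      (S - z.1 ^ (γ + 1) * xDeriv (fun w => Y w i) z * T) =
      (P (graphMap Y' z) - P (graphMap Y z) - S) -
      z.1 ^ (γ + 1) * xDeriv (fun w => Y w i) z * (q (graphMap Y' z) - q (graphMap Y z) - T) -
      (q (graphMap Y' z) - q (graphMap Y z)) * (z.1 ^ γ * (z.1 * D)) := by
    rw [← e, ← e', hx]
    ring
  have b₁ : |P (graphMap Y' z) - P (graphMap Y z) - S| ≤ |C₁| * r ^ 2 :=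
    k₁.trans (mul_le_mul_of_nonneg_right (le_abs_self _) (sq_nonneg _))
  have b₂ : |z.1 ^ (γ + 1) * xDeriv (fun w => Y w i) z *
      (q (graphMap Y' z) - q (graphMap Y z) - T)| ≤ |C₂| * r ^ 2 := by
    rw [abs_mul]
    refine (mul_le_of_le_one_left (abs_nonneg _) d.le).trans (k₂.trans ?_)
    exact mul_le_mul_of_nonneg_right (le_abs_self _) (sq_nonneg _)
  have b₃ : |(q (graphMap Y' z) - q (graphMap Y z)) * (z.1 ^ γ * (z.1 * D))| ≤
      |C₃| * (r * |z.1 * D|) := by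
    rw [abs_mul, ← mul_assoc |C₃|]
    refine mul_le_mul (k₃.trans (mul_le_mul_of_nonneg_right (le_abs_self _) hr)) ?_
      (abs_nonneg _) (by positivity)
    rw [abs_mul, abs_pow]
    exact mul_le_of_le_one_left (abs_nonneg _) (pow_le_one₀ (abs_nonneg _) d'.le)
  rw [key]
  refine ((abs_sub _ _).trans (add_le_add (abs_sub _ _) le_rfl)).trans ?_
  have p₁ : 0 ≤ |C₁| * (r * |z.1 * D|) := by positivity
  have p₂ : 0 ≤ |C₂| * (r * |z.1 * D|) := by positivity
  have p₃ : 0 ≤ |C₃| * r ^ 2 := by positivity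
  nlinarith

end Linearization

section FiniteDetermination

open PowerSeries

variable {E : Type*} [NormedAddCommGroup E] [NormedSpace ℝ E] {n : ℕ}

lemma X_pow_two_mul_dvd_of_error_bound {v : ℝ × E → Fin n → ℝ}
    {V : Fin n → (analyticGermRing E)⟦X⟧} (hv : ∀ i, HasExpansion (fun z => v z i) (V i))
    {err : ℝ × E → ℝ} {Err : (analyticGermRing E)⟦X⟧} (herr : HasExpansion err Err) {i : Fin n}
    {C : ℝ} (hC : ∀ᶠ z in 𝓝 0, |err z| ≤
      C * (‖v z‖ * ‖v z‖ + ‖v z‖ * |z.1 * xDeriv (fun w => v w i) z|))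
    {N : ℕ} (hN : ∀ j, X ^ N ∣ V j) : X ^ (2 * N) ∣ Err := by
  have hx : HasExpansion ((fun z : ℝ × E => z.1) * xDeriv fun w => v w i)
      (X * derivative _ (V i)) := hasExpansion_fst.mul (hv i).deriv_fst
  have hxN : X ^ N ∣ X * derivative _ (V i) := by
    obtain ⟨u, hu⟩ := hN i
    rw [hu, Derivation.leibniz, Derivation.leibniz_pow, derivative_X]
    rcases N with _ | N
    · simp
    · refine ⟨X * derivative _ u + ((N + 1 : ℕ) : (analyticGermRing E)⟦X⟧) * u, ?_⟩
      simp only [smul_eq_mul, nsmul_eq_mul, Nat.add_sub_cancel]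
      ring
  have hcurry : ∀ᶠ θ : E in 𝓝 0, ∀ᶠ t : ℝ in 𝓝 0, |err (t, θ)| ≤ C * (‖v (t, θ)‖ * ‖v (t, θ)‖ +
      ‖v (t, θ)‖ * |t * xDeriv (fun w => v w i) (t, θ)|) := by
    have hswap : Tendsto (fun w : E × ℝ => (w.2, w.1)) (𝓝 (0, 0)) (𝓝 (0 : ℝ × E)) :=
      continuous_swap.tendsto' _ _ rfl
    exact (hswap.eventually hC).curry_nhds
  refine (herr.X_pow_dvd_iff _).2 ?_
  filter_upwards [hcurry, Filter.eventually_all.2 fun j => ((hv j).X_pow_dvd_iff N).1 (hN j),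
    Filter.eventually_all.2 fun j => eventually_analyticAt_slice (hv j).analyticAt,
    (hx.X_pow_dvd_iff N).1 hxN, eventually_analyticAt_slice hx.analyticAt,
    eventually_analyticAt_slice herr.analyticAt] with θ hb hord han hordx hanx hane
  rw [hane.natCast_le_analyticOrderAt_iff_isBigO]
  rw [hanx.natCast_le_analyticOrderAt_iff_isBigO] at hordx
  have hnorm : (fun t : ℝ => ‖v (t, θ)‖) =O[𝓝 0] fun t => t ^ N :=
    (Asymptotics.isBigO_pi.2 fun j =>
      (han j).natCast_le_analyticOrderAt_iff_isBigO N |>.1 (hord j)).norm_left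
  have hall := (hnorm.mul hnorm).add (hnorm.mul hordx.abs_left)
  refine Asymptotics.IsBigO.trans (Asymptotics.IsBigO.of_bound C ?_)
    (hall.congr_right fun t => by rw [two_mul, pow_add])
  filter_upwards [hb] with t ht
  rw [Real.norm_eq_abs, Real.norm_of_nonneg (by positivity)]
  exact ht

lemma natCast_le_analyticOrderAt_apply_sub {f g : ℝ → Fin n → ℝ} (hf : AnalyticAt ℝ f 0)
    (hg : AnalyticAt ℝ g 0) {N : ℕ} (h : ∀ l < N, deriv^[l] f 0 = deriv^[l] g 0) (i : Fin n) :
    (N : ℕ∞) ≤ analyticOrderAt (fun t => f t i - g t i) 0 := by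
  have h1 : (N : ℕ∞) ≤ analyticOrderAt (f - g) 0 := by
    rw [natCast_le_analyticOrderAt_iff_iteratedDeriv_eq_zero (hf.sub hg)]
    intro l hl
    rw [iteratedDeriv_sub hf.contDiffAt hg.contDiffAt, iteratedDeriv_eq_iterate,
      iteratedDeriv_eq_iterate, h l hl, sub_self]
  obtain ⟨u, hu, hfu⟩ := (natCast_le_analyticOrderAt (hf.sub hg)).1 h1
  refine (natCast_le_analyticOrderAt
    ((analyticAt_pi_iff.1 hf i).sub (analyticAt_pi_iff.1 hg i))).2
    ⟨fun t => u t i, analyticAt_pi_iff.1 hu i, ?_⟩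
  filter_upwards [hfu] with t ht
  exact congrFun ht i

lemma eventually_component_equation {γ : ℕ} {p : ℝ × (Fin n → ℝ) × E → Fin n → ℝ}
    {q : ℝ × (Fin n → ℝ) × E → ℝ} {y : ℝ → E → Fin n → ℝ}
    (hy : AnalyticAt ℝ (fun x : ℝ × E => y x.1 x.2) 0)
    (heq : ∀ᶠ x : ℝ × E in 𝓝 0,
      (q (x.1, y x.1 x.2, x.2) * x.1 ^ (γ + 1)) • deriv (fun t => y t x.2) x.1 =
        p (x.1, y x.1 x.2, x.2)) (i : Fin n) :
    ∀ᶠ x : ℝ × E in 𝓝 0, q (graphMap (fun x => y x.1 x.2) x) * x.1 ^ (γ + 1) *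
      xDeriv (fun w => y w.1 w.2 i) x = p (graphMap (fun x => y x.1 x.2) x) i := by
  filter_upwards [heq, hy.eventually_analyticAt] with x hx ha
  have h : deriv (fun t => y t x.2) x.1 i = xDeriv (fun w => y w.1 w.2 i) x := by
    rw [deriv_pi fun j => (analyticAt_pi_iff.1 ha j).slice.differentiableAt]
    rfl
  have hxi := congrFun hx i
  rwa [Pi.smul_apply, smul_eq_mul, h] at hxi

end FiniteDetermination

/-- Theorem 5.1: finite jet determination for solutions of the singular
ODE `x^{γ+1} ∂ₓ y(x,θ) = p(x, y(x,θ), θ) / q(x, y(x,θ), θ)` (written in the multiplied-out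
form `q·x^{γ+1}·∂ₓy = p`). If `ŷ` is a real-analytic solution near `0` with `ŷ(0,θ) ≡ 0`,
then there is `k ≥ 0` such that any real-analytic solution `y` near `0` whose derivatives
`∂ₓ^l y(0,θ)`, `0 ≤ l ≤ k`, agree with those of `ŷ` for all `θ` near `0` coincides with
`ŷ` near `0`. -/
theorem finite_jet_determination_singular_ODE
    (γ n m : ℕ) (hn : 1 ≤ n) (hm : 1 ≤ m)
    (p : ℝ × (Fin n → ℝ) × (Fin m → ℝ) → Fin n → ℝ)
    (q : ℝ × (Fin n → ℝ) × (Fin m → ℝ) → ℝ)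
    (hp : AnalyticAt ℝ p 0) (hq : AnalyticAt ℝ q 0)
    (hq0 : ¬ ∀ᶠ θ : Fin m → ℝ in 𝓝 0, q (0, 0, θ) = 0)
    (yh : ℝ → (Fin m → ℝ) → Fin n → ℝ)
    (hyh : AnalyticAt ℝ (fun x : ℝ × (Fin m → ℝ) => yh x.1 x.2) 0)
    (hyh0 : ∀ᶠ θ : Fin m → ℝ in 𝓝 0, yh 0 θ = 0)
    (heq : ∀ᶠ x : ℝ × (Fin m → ℝ) in 𝓝 0,
      (q (x.1, yh x.1 x.2, x.2) * x.1 ^ (γ + 1)) • deriv (fun t => yh t x.2) x.1 =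
        p (x.1, yh x.1 x.2, x.2)) :
    ∃ k : ℕ, ∀ y : ℝ → (Fin m → ℝ) → Fin n → ℝ,
      AnalyticAt ℝ (fun x : ℝ × (Fin m → ℝ) => y x.1 x.2) 0 →
      (∀ᶠ x : ℝ × (Fin m → ℝ) in 𝓝 0,
        (q (x.1, y x.1 x.2, x.2) * x.1 ^ (γ + 1)) • deriv (fun t => y t x.2) x.1 =
          p (x.1, y x.1 x.2, x.2)) →
      (∀ᶠ θ : Fin m → ℝ in 𝓝 0, ∀ l ≤ k,
        deriv^[l] (fun t => y t θ) 0 = deriv^[l] (fun t => yh t θ) 0) →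
      ∀ᶠ x : ℝ × (Fin m → ℝ) in 𝓝 0, y x.1 x.2 = yh x.1 x.2 := by
  have hYh0 : (fun x : ℝ × (Fin m → ℝ) => yh x.1 x.2) 0 = 0 := hyh0.self_of_nhds
  have hpi : ∀ i, AnalyticAt ℝ (fun w => p w i) 0 := analyticAt_pi_iff.1 hp
  obtain ⟨Q, hQ⟩ := exists_hasExpansion (hq.comp_graphMap hyh hYh0)
  have hB := fun i j : Fin n =>
    exists_hasExpansion (analyticAt_linearizedCoeff γ (hpi i) hq hyh hYh0 i j)
  choose B hB using hB
  have hQ0 : PowerSeries.constantCoeff Q ≠ 0 := by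
    intro h
    rw [← PowerSeries.coeff_zero_eq_constantCoeff_apply, hQ.coeff_eq_zero_iff] at h
    refine hq0 ?_
    filter_upwards [h, hyh0] with θ hθ hθ'
    simpa [graphMap, hθ'] using hθ
  obtain ⟨K, hK⟩ := exists_forall_X_pow_succ_dvd_of_system γ hQ0 B
  refine ⟨K, fun y hy hyeq hjet => ?_⟩
  have hY0 : (fun x : ℝ × (Fin m → ℝ) => y x.1 x.2) 0 = 0 :=
    (hjet.self_of_nhds 0 (Nat.zero_le K)).trans hYh0
  have hV := fun i => exists_hasExpansion
    ((analyticAt_pi_iff.1 hy i).sub (analyticAt_pi_iff.1 hyh i))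
  choose V hV using hV
  have hstart : ∀ i, PowerSeries.X ^ (K + 1) ∣ V i := by
    intro i
    refine ((hV i).X_pow_dvd_iff _).2 ?_
    filter_upwards [hjet, tendsto_slice.eventually hy.eventually_analyticAt,
      tendsto_slice.eventually hyh.eventually_analyticAt] with θ hθ ha ha'
    exact natCast_le_analyticOrderAt_apply_sub
      (AnalyticAt.fun_comp (g := fun x : ℝ × (Fin m → ℝ) => y x.1 x.2)
        (f := fun t : ℝ => (t, θ)) ha (by fun_prop))
      (AnalyticAt.fun_comp (g := fun x : ℝ × (Fin m → ℝ) => yh x.1 x.2)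
        (f := fun t : ℝ => (t, θ)) ha' (by fun_prop))
      (fun l hl => hθ l (Nat.lt_succ_iff.1 hl)) i
  have hsys : ∀ N, (∀ j, PowerSeries.X ^ N ∣ V j) → ∀ i, PowerSeries.X ^ (2 * N) ∣
      singularDerivation Q γ (V i) - ∑ j, B i j * V j := by
    intro N hN i
    obtain ⟨C, hC⟩ := exists_linearization_error_bound (hpi i) hq hyh hYh0 hy hY0
      (eventually_component_equation hyh heq i) (eventually_component_equation hy hyeq i)
    have herr := ((hQ.mul (hasExpansion_fst.pow (γ + 1))).mul (hV i).deriv_fst).sub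
      (HasExpansion.sum Finset.univ fun j => (hB i j).mul (hV j))
    refine X_pow_two_mul_dvd_of_error_bound
      (v := fun x => y x.1 x.2 - yh x.1 x.2) (C := C) (i := i) hV herr ?_ hN
    filter_upwards [hC] with z hz
    simp only [Pi.sub_apply, Pi.mul_apply, Pi.pow_apply, Finset.sum_apply]
    exact hz
  have hall : ∀ M i, PowerSeries.X ^ (K + 1 + M) ∣ V i := by
    intro M
    induction M with
    | zero => exact hstart
    | succ M ih => exact hK (K + 1 + M) (by omega) V ih (hsys _ ih)
  have hV0 : ∀ i, V i = 0 := by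
    intro i
    ext1 l
    rw [map_zero]
    exact PowerSeries.X_pow_dvd_iff.1 (hall l i) l (by omega)
  have hzero := fun i => HasExpansion.eventually_eq_zero (hV0 i ▸ hV i)
  filter_upwards [Filter.eventually_all.2 hzero] with x hx
  exact funext fun i => sub_eq_zero.1 (hx i)
end
end
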